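/- arXiv:1105.1239 — 5 statements merged into one kernel-verified Lean document; each statement's English description precedes it below -/
import Mathlib

section
/- Let k, κ : (0,∞) → [0,∞) be locally integrable functions such that κ(s) = ∫_{[0,∞)} e^{−λs} η(dλ) for a Borel measure η on [0,∞) with ∫_{[0,∞)} (1+λ)^{−1} η(dλ) < ∞, and suppose the Sonine condition holds: ∫₀ᵗ k(t−τ) κ(τ) dτ = 1 for all t > 0. Then for every measurable, locally bounded function f on (0,∞), the function v(t) = ∫₀ᵗ κ(t−s) f(s) ds satisfies: (1) v(t) → 0 as t → 0+; (2) ∫₀ᵗ k(t−s) v(s) ds = ∫₀ᵗ f(τ) dτ for all t > 0, so that t ↦ ∫₀ᵗ k(t−s) v(s) ds is locally absolutely continuous; and consequently (3) the generalized fractional derivative (D_(k) v)(t) = (d/dt) ∫₀ᵗ k(t−s) v(s) ds − k(t)·v(0+) exists and equals f(t) for almost every t > 0. -/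
open MeasureTheory Filter Set

/-- The convolution of a locally integrable `κ` with a locally bounded `f` vanishes at `0+`. -/
theorem tendsto_setIntegral_sub_mul_nhdsGT_zero {κ f : ℝ → ℝ}
    (hκ_loc : ∀ T, 0 < T → IntegrableOn κ (Ioc 0 T))
    (hf_locbd : ∀ T, 0 < T → ∃ C, ∀ s ∈ Ioc (0 : ℝ) T, |f s| ≤ C) :
    Tendsto (fun t => ∫ s in Ioc 0 t, κ (t - s) * f s) (nhdsWithin 0 (Ioi 0)) (nhds 0) := by
  obtain ⟨C, hC⟩ := hf_locbd 1 one_pos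
  have hint : IntervalIntegrable (fun x => |κ x|) volume 0 1 :=
    (intervalIntegrable_iff_integrableOn_Ioc_of_le zero_le_one).2 (hκ_loc 1 one_pos).abs
  have hprim : Tendsto (fun t => ∫ x in (0 : ℝ)..t, |κ x|) (nhdsWithin 0 (Ioi 0)) (nhds 0) := by
    have h := intervalIntegral.continuousOn_primitive_interval' hint left_mem_uIcc 0 left_mem_uIcc
    rw [uIcc_of_le (zero_le_one' ℝ), ContinuousWithinAt, intervalIntegral.integral_same] at h
    exact h.mono_left (nhdsWithin_le_of_mem (mem_of_superset
      (Ioo_mem_nhdsGT (zero_lt_one' ℝ)) Ioo_subset_Icc_self))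
  have hbound : Tendsto (fun t => C * ∫ x in (0 : ℝ)..t, |κ x|)
      (nhdsWithin 0 (Ioi 0)) (nhds 0) := by
    simpa using hprim.const_mul C
  refine squeeze_zero_norm' ?_ hbound
  filter_upwards [Ioo_mem_nhdsGT (zero_lt_one' ℝ)] with t ht
  have hint_t : IntervalIntegrable (fun x => |κ x|) volume 0 t :=
    (intervalIntegrable_iff_integrableOn_Ioc_of_le ht.1.le).2 (hκ_loc t ht.1).abs
  have hrefl : IntervalIntegrable (fun s => |κ (t - s)|) volume 0 t := by
    simpa using (hint_t.comp_sub_left t).symm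
  have hsub : ∫ x in (0 : ℝ)..t, |κ x| = ∫ s in (0 : ℝ)..t, |κ (t - s)| := by
    simp [intervalIntegral.integral_comp_sub_left (fun x => |κ x|) t]
  rw [hsub, ← intervalIntegral.integral_const_mul, intervalIntegral.integral_of_le ht.1.le]
  refine norm_integral_le_of_norm_le ((hrefl.const_mul C).1) ?_
  filter_upwards [ae_restrict_mem measurableSet_Ioc] with s hs
  rw [norm_mul, Real.norm_eq_abs, Real.norm_eq_abs, mul_comm]
  exact mul_le_mul_of_nonneg_right (hC s ⟨hs.1, hs.2.trans ht.2.le⟩) (abs_nonneg _)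

/-- Fubini for an iterated convolution over `(0, t)`: integrating `k` against `κ * f` is the same
as integrating `f` against `k * κ`. -/
theorem setIntegral_sub_mul_setIntegral_sub_mul {k κ f : ℝ → ℝ} {t C : ℝ}
    (hk : IntegrableOn k (Ioo 0 t)) (hκ : IntegrableOn κ (Ioo 0 t))
    (hf : Measurable f) (hC : ∀ s ∈ Ioo (0 : ℝ) t, |f s| ≤ C) :
    (∫ s in Ioo 0 t, k (t - s) * ∫ r in Ioo 0 s, κ (s - r) * f r) =
      ∫ r in Ioo 0 t, (∫ x in Ioo 0 (t - r), k (t - r - x) * κ x) * f r := by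
  set K := (Ioo 0 t).indicator k with hK
  set L := (Ioo 0 t).indicator κ with hL
  set F := (Ioo 0 t).indicator f with hF
  have hKi : Integrable K := hk.integrable_indicator measurableSet_Ioo
  have hLi : Integrable L := hκ.integrable_indicator measurableSet_Ioo
  have hFm : Measurable F := hf.indicator measurableSet_Ioo
  have hFb (r : ℝ) : ‖F r‖ ≤ |C| := by
    by_cases hr : r ∈ Ioo 0 t
    · simpa [hF, hr] using (hC r hr).trans (le_abs_self C)
    · simp [hF, hr]
  have hprod : Integrable (fun p : ℝ × ℝ => K (t - p.1) * L (p.1 - p.2) * F p.2)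
      (volume.prod volume) := by
    have h := (hKi.comp_sub_left t).convolution_integrand (ContinuousLinearMap.mul ℝ ℝ)
      (hLi.comp_neg)
    have h' := h.swap
    refine Integrable.mul_bdd (c := |C|) ?_
      (hFm.comp measurable_snd).aestronglyMeasurable (ae_of_all _ fun p => hFb p.2)
    simpa [Function.comp_def, Prod.swap] using h'
  have hleft : (∫ s in Ioo 0 t, k (t - s) * ∫ r in Ioo 0 s, κ (s - r) * f r) =
      ∫ s, ∫ r, K (t - s) * L (s - r) * F r := by
    rw [← integral_indicator measurableSet_Ioo]
    refine integral_congr_ae (ae_of_all _ fun s => ?_)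
    by_cases hs : s ∈ Ioo 0 t
    · have hs' : t - s ∈ Ioo 0 t := ⟨by linarith [hs.2], by linarith [hs.1]⟩
      simp only [indicator_of_mem hs, mul_assoc, integral_const_mul, hK, indicator_of_mem hs']
      rw [← integral_indicator measurableSet_Ioo]
      congr 2
      ext r
      simp only [hL, hF, indicator, mem_Ioo] at hs ⊢
      grind
    · have hs' : t - s ∉ Ioo 0 t := fun h => hs ⟨by linarith [h.2], by linarith [h.1]⟩
      simp [indicator_of_notMem hs, hK, indicator_of_notMem hs']
  have hright : (∫ r in Ioo 0 t, (∫ x in Ioo 0 (t - r), k (t - r - x) * κ x) * f r) =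
      ∫ r, ∫ s, K (t - s) * L (s - r) * F r := by
    rw [← integral_indicator measurableSet_Ioo]
    refine integral_congr_ae (ae_of_all _ fun r => ?_)
    by_cases hr : r ∈ Ioo 0 t
    · simp only [indicator_of_mem hr, integral_mul_const, hF]
      have hshift := integral_sub_right_eq_self (μ := volume) (fun x => K (t - r - x) * L x) r
      simp only [sub_sub_sub_cancel_right] at hshift
      rw [hshift, ← integral_indicator measurableSet_Ioo]
      congr 2
      ext x
      simp only [hL, hK, indicator, mem_Ioo] at hr ⊢
      grind
    · simp [indicator_of_notMem hr, hF]
  rw [hleft, hright]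
  exact integral_integral_swap hprod

/-- The primitive of a measurable function bounded on every `(0, T]` is differentiable at almost
every point of `(0, ∞)`, with the expected derivative. -/
theorem ae_hasDerivAt_setIntegral_Ioc {f : ℝ → ℝ} (hf_meas : Measurable f)
    (hf_locbd : ∀ T, 0 < T → ∃ C, ∀ s ∈ Ioc (0 : ℝ) T, |f s| ≤ C) :
    ∀ᵐ t ∂(volume.restrict (Ioi 0)),
      HasDerivAt (fun r => ∫ τ in Ioc 0 r, f τ) (f t) t := by
  have hloc : LocallyIntegrable ((Ioi 0).indicator f) volume := by
    intro x
    obtain ⟨C, hC⟩ := hf_locbd (|x| + 1) (by positivity)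
    refine ⟨Ioo (x - 1) (x + 1), Ioo_mem_nhds (by linarith) (by linarith), ?_⟩
    refine Measure.integrableOn_of_bounded (M := |C|) measure_Ioo_lt_top.ne
      (hf_meas.indicator measurableSet_Ioi).aestronglyMeasurable ?_
    filter_upwards [ae_restrict_mem measurableSet_Ioo] with y hy
    by_cases h0 : y ∈ Ioi (0 : ℝ)
    · rw [indicator_of_mem h0]
      exact (hC y ⟨h0, by linarith [hy.2, le_abs_self x]⟩).trans (le_abs_self C)
    · simp [indicator_of_notMem h0]
  filter_upwards [ae_restrict_of_ae (_root_.LocallyIntegrable.ae_hasDerivAt_integral hloc),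
    ae_restrict_mem measurableSet_Ioi] with t ht ht0
  have h := ht 0
  rw [indicator_of_mem ht0] at h
  refine h.congr_of_eventuallyEq ?_
  filter_upwards [Ioi_mem_nhds ht0] with r hr
  rw [intervalIntegral.integral_of_le (le_of_lt hr)]
  exact setIntegral_congr_fun measurableSet_Ioc fun τ hτ => (indicator_of_mem hτ.1 f).symm

/-- If `k, κ` are nonnegative locally integrable Sonine kernels
(`∫₀ᵗ k(t-τ) κ(τ) dτ = 1`), with `κ(s) = ∫ e^{-λs} η(dλ)` for a Borel measure `η`
with `∫ (1+λ)⁻¹ η(dλ) < ∞`, then for every measurable locally bounded `f` on `(0,∞)`,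
the function `v(t) = ∫₀ᵗ κ(t-s) f(s) ds` satisfies `v(t) → 0` as `t → 0+`,
`∫₀ᵗ k(t-s) v(s) ds = ∫₀ᵗ f(τ) dτ`, and `(D_(k) v)(t) = f(t)` for a.e. `t > 0`. -/
theorem statement0
    (k κ f : ℝ → ℝ) (η : Measure ℝ)
    (hk_nonneg : ∀ t, 0 < t → 0 ≤ k t)
    (hκ_nonneg : ∀ t, 0 < t → 0 ≤ κ t)
    (hk_loc : ∀ T, 0 < T → IntegrableOn k (Set.Ioc 0 T))
    (hκ_loc : ∀ T, 0 < T → IntegrableOn κ (Set.Ioc 0 T))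
    (hη_int : IntegrableOn (fun l => (1 + l)⁻¹) (Set.Ici 0) η)
    (hκ_rep : ∀ s, 0 < s → κ s = ∫ l in Set.Ici 0, Real.exp (-l * s) ∂η)
    (hSonine : ∀ t, 0 < t → ∫ τ in Set.Ioc 0 t, k (t - τ) * κ τ = 1)
    (hf_meas : Measurable f)
    (hf_locbd : ∀ T, 0 < T → ∃ C, ∀ s ∈ Set.Ioc (0 : ℝ) T, |f s| ≤ C) :
    -- (1) v(t) → 0 as t → 0+
    Filter.Tendsto (fun t => ∫ s in Set.Ioc 0 t, κ (t - s) * f s)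
      (nhdsWithin 0 (Set.Ioi 0)) (nhds 0) ∧
    -- (2) (k * v)(t) = ∫₀ᵗ f
    (∀ t, 0 < t →
      (∫ s in Set.Ioc 0 t, k (t - s) * ∫ r in Set.Ioc 0 s, κ (s - r) * f r)
        = ∫ τ in Set.Ioc 0 t, f τ) ∧
    -- (3) (d/dt)(k * v)(t) = f(t) for a.e. t > 0; since v(0+) = 0 this means
    --     (D_(k) v)(t) = f(t) a.e.
    (∀ᵐ t ∂(volume.restrict (Set.Ioi 0)),
      HasDerivAt
        (fun r => ∫ s in Set.Ioc 0 r, k (r - s) * ∫ q in Set.Ioc 0 s, κ (s - q) * f q)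
        (f t) t) := by
  have hconv : ∀ t, 0 < t →
      (∫ s in Set.Ioc 0 t, k (t - s) * ∫ r in Set.Ioc 0 s, κ (s - r) * f r)
        = ∫ τ in Set.Ioc 0 t, f τ := by
    intro t ht
    obtain ⟨C, hC⟩ := hf_locbd t ht
    have hfubini := setIntegral_sub_mul_setIntegral_sub_mul
      ((hk_loc t ht).mono_set Ioo_subset_Ioc_self) ((hκ_loc t ht).mono_set Ioo_subset_Ioc_self)
      hf_meas fun s hs => hC s (Ioo_subset_Ioc_self hs)
    simp only [integral_Ioc_eq_integral_Ioo] at hSonine ⊢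
    rw [hfubini]
    refine setIntegral_congr_fun measurableSet_Ioo fun r hr => ?_
    simp only [hSonine (t - r) (sub_pos.2 hr.2), one_mul]
  refine ⟨tendsto_setIntegral_sub_mul_nhdsGT_zero hκ_loc hf_locbd, hconv, ?_⟩
  filter_upwards [ae_hasDerivAt_setIntegral_Ioc hf_meas hf_locbd,
    ae_restrict_mem measurableSet_Ioi] with t ht ht0
  refine ht.congr_of_eventuallyEq ?_
  filter_upwards [Ioi_mem_nhds ht0] with r hr using hconv r hr
end

section
/- Let k, κ : (0,∞) → [0,∞) be locally integrable functions satisfying the Sonine condition ∫₀ᵗ k(t−τ) κ(τ) dτ = 1 for all t > 0. If u is locally absolutely continuous on [0,∞), then for almost every s > 0 the derivative (d/ds) ∫₀ˢ k(s−τ) u(τ) dτ exists, and for every t > 0 one has ∫₀ᵗ κ(t−s) [ (d/ds) ∫₀ˢ k(s−τ) u(τ) dτ − k(s) u(0) ] ds = u(t) − u(0). -/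
open MeasureTheory Filter Set

/-- The convolution `∫₀ᵗ f(t-τ) g(τ) dτ` of functions on the half-line. -/
noncomputable def causalConv (f g : ℝ → ℝ) (t : ℝ) : ℝ :=
  ∫ τ in Ioc 0 t, f (t - τ) * g τ

theorem causalConv_eq_Ioo (f g : ℝ → ℝ) (t : ℝ) :
    causalConv f g t = ∫ τ in Ioo 0 t, f (t - τ) * g τ :=
  integral_Ioc_eq_integral_Ioo

theorem causalConv_comm (f g : ℝ → ℝ) {t : ℝ} (ht : 0 ≤ t) :
    causalConv f g t = causalConv g f t := by
  unfold causalConv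
  rw [← intervalIntegral.integral_of_le ht, ← intervalIntegral.integral_of_le ht]
  have h := intervalIntegral.integral_comp_sub_left (a := 0) (b := t)
    (fun x => f (t - x) * g x) t
  simp only [sub_sub_cancel, sub_self, sub_zero] at h
  rw [← h]
  exact intervalIntegral.integral_congr fun x _ => mul_comm _ _

theorem causalConv_one_left (f : ℝ → ℝ) (t : ℝ) :
    causalConv (fun _ => 1) f t = ∫ s in Ioc 0 t, f s := by
  simp [causalConv]

section Associativity

variable {f g h : ℝ → ℝ} {t C : ℝ}

theorem indicator_conv_mul_eq (f g h : ℝ → ℝ) (t s : ℝ) :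
    ∫ τ, (Ioo 0 t).indicator f (t - s) * (Ioo 0 t).indicator g (s - τ) * (Ioo 0 t).indicator h τ =
      (Ioo 0 t).indicator (fun s => f (t - s) * causalConv g h s) s := by
  by_cases hs : s ∈ Ioo 0 t
  · have h1 : t - s ∈ Ioo 0 t := ⟨by linarith [hs.2], by linarith [hs.1]⟩
    rw [indicator_of_mem hs, causalConv_eq_Ioo, ← integral_const_mul,
      ← integral_indicator measurableSet_Ioo]
    congr 1
    ext τ
    rw [indicator_of_mem h1]
    by_cases hτ : τ ∈ Ioo 0 s
    · rw [indicator_of_mem hτ, indicator_of_mem, indicator_of_mem, mul_assoc]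
      · exact ⟨hτ.1, hτ.2.trans hs.2⟩
      · exact ⟨by linarith [hτ.2], by linarith [hτ.1, hs.2]⟩
    · rw [indicator_of_notMem hτ]
      by_cases h0 : 0 < τ
      · rw [indicator_of_notMem (a := s - τ)]
        · simp
        · exact fun h => hτ ⟨h0, by linarith [h.1]⟩
      · rw [indicator_of_notMem (a := τ)]
        · simp
        · exact fun h => h0 h.1
  · have h1 : t - s ∉ Ioo 0 t := fun h => hs ⟨by linarith [h.2], by linarith [h.1]⟩
    simp [indicator_of_notMem hs, indicator_of_notMem h1]

theorem indicator_mul_indicator_shift (f g : ℝ → ℝ) {t τ : ℝ} (hτ : τ ∈ Ioo 0 t) (s : ℝ) :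
    (Ioo 0 t).indicator f (t - s) * (Ioo 0 t).indicator g (s - τ) =
      (Ioo 0 (t - τ)).indicator (fun σ => f (t - τ - σ) * g σ) (s - τ) := by
  by_cases hs : s - τ ∈ Ioo 0 (t - τ)
  · rw [indicator_of_mem hs, indicator_of_mem, indicator_of_mem]
    · congr 2; ring
    · exact ⟨hs.1, by linarith [hs.2, hτ.1]⟩
    · exact ⟨by linarith [hs.2], by linarith [hs.1, hτ.1]⟩
  · rw [indicator_of_notMem hs]
    by_cases h0 : 0 < s - τ
    · rw [indicator_of_notMem (a := t - s), zero_mul]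
      exact fun h => hs ⟨h0, by linarith [h.1]⟩
    · rw [indicator_of_notMem (a := s - τ), mul_zero]
      exact fun h => h0 h.1

theorem integral_indicator_mul_indicator (f g : ℝ → ℝ) {t τ : ℝ} (hτ : τ ∈ Ioo 0 t) :
    ∫ s, (Ioo 0 t).indicator f (t - s) * (Ioo 0 t).indicator g (s - τ) =
      causalConv f g (t - τ) := by
  simp_rw [indicator_mul_indicator_shift f g hτ]
  rw [integral_sub_right_eq_self (μ := volume)
    ((Ioo 0 (t - τ)).indicator (fun σ => f (t - τ - σ) * g σ)) τ,
    integral_indicator measurableSet_Ioo, causalConv_eq_Ioo]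

/-- The triple product underlying associativity of `causalConv` is integrable as soon as the
convolution of the two nonnegative factors is bounded. -/
theorem integrable_triple_product
    (hf : IntegrableOn f (Ioc 0 t)) (hg : IntegrableOn g (Ioc 0 t)) (hh : IntegrableOn h (Ioc 0 t))
    (hf0 : ∀ s, 0 < s → 0 ≤ f s) (hg0 : ∀ s, 0 < s → 0 ≤ g s)
    (hfg : ∀ s ∈ Ioc 0 t, IntegrableOn (fun τ => f (s - τ) * g τ) (Ioc 0 s))
    (hC : ∀ s ∈ Ioc 0 t, causalConv f g s ≤ C) :
    Integrable (fun p : ℝ × ℝ => (Ioo 0 t).indicator f (t - p.1) *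
      (Ioo 0 t).indicator g (p.1 - p.2) * (Ioo 0 t).indicator h p.2)
      (volume.prod volume) := by
  have hF : Integrable ((Ioo 0 t).indicator f) :=
    (integrable_indicator_iff measurableSet_Ioo).2 (hf.mono_set Ioo_subset_Ioc_self)
  have hG : Integrable ((Ioo 0 t).indicator g) :=
    (integrable_indicator_iff measurableSet_Ioo).2 (hg.mono_set Ioo_subset_Ioc_self)
  have hH : Integrable ((Ioo 0 t).indicator h) :=
    (integrable_indicator_iff measurableSet_Ioo).2 (hh.mono_set Ioo_subset_Ioc_self)
  have hF0 : ∀ s, 0 ≤ (Ioo 0 t).indicator f s := indicator_nonneg fun s hs => hf0 s hs.1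
  have hG0 : ∀ s, 0 ≤ (Ioo 0 t).indicator g s := indicator_nonneg fun s hs => hg0 s hs.1
  have hmeas : AEStronglyMeasurable (fun p : ℝ × ℝ => (Ioo 0 t).indicator f (t - p.1) *
      (Ioo 0 t).indicator g (p.1 - p.2) * (Ioo 0 t).indicator h p.2)
      (volume.prod volume) := by
    refine AEStronglyMeasurable.mul (AEStronglyMeasurable.mul ?_ ?_) ?_
    · exact (hF.comp_sub_left t).aestronglyMeasurable.comp_fst
    · exact hG.aestronglyMeasurable.comp_quasiMeasurePreserving
        (quasiMeasurePreserving_sub_of_right_invariant volume volume)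
    · exact hH.aestronglyMeasurable.comp_snd
  rw [integrable_prod_iff' hmeas]
  have hslice : ∀ τ, Integrable fun s => (Ioo 0 t).indicator f (t - s) *
      (Ioo 0 t).indicator g (s - τ) * (Ioo 0 t).indicator h τ := by
    intro τ
    by_cases hτ : τ ∈ Ioo 0 t
    · simp_rw [indicator_mul_indicator_shift f g hτ]
      refine Integrable.mul_const (Integrable.comp_sub_right
        ((integrable_indicator_iff measurableSet_Ioo).2 ?_) τ) _
      exact (hfg (t - τ) ⟨by linarith [hτ.2], by linarith [hτ.1]⟩).mono_set Ioo_subset_Ioc_self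
    · simp [indicator_of_notMem hτ]
  refine ⟨Eventually.of_forall hslice, ?_⟩
  refine Integrable.mono' (hH.norm.const_mul C) hmeas.prod_swap.norm.integral_prod_right'
    (Eventually.of_forall fun τ => ?_)
  rw [Real.norm_of_nonneg (integral_nonneg fun _ => norm_nonneg _)]
  by_cases hτ : τ ∈ Ioo 0 t
  · simp only [norm_mul, Real.norm_of_nonneg (hF0 _), Real.norm_of_nonneg (hG0 _)]
    rw [integral_mul_const, integral_indicator_mul_indicator f g hτ]
    gcongr
    exact hC _ ⟨by linarith [hτ.2], by linarith [hτ.1]⟩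
  · simp [indicator_of_notMem hτ]

theorem causalConv_assoc_and_integrableOn
    (hf : IntegrableOn f (Ioc 0 t)) (hg : IntegrableOn g (Ioc 0 t)) (hh : IntegrableOn h (Ioc 0 t))
    (hf0 : ∀ s, 0 < s → 0 ≤ f s) (hg0 : ∀ s, 0 < s → 0 ≤ g s)
    (hfg : ∀ s ∈ Ioc 0 t, IntegrableOn (fun τ => f (s - τ) * g τ) (Ioc 0 s))
    (hC : ∀ s ∈ Ioc 0 t, causalConv f g s ≤ C) :
    causalConv f (causalConv g h) t = causalConv (causalConv f g) h t ∧
      IntegrableOn (fun s => f (t - s) * causalConv g h s) (Ioc 0 t) := by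
  have hint := integrable_triple_product hf hg hh hf0 hg0 hfg hC
  constructor
  · have hswap := integral_integral_swap (f := fun s τ => (Ioo 0 t).indicator f (t - s) *
      (Ioo 0 t).indicator g (s - τ) * (Ioo 0 t).indicator h τ) hint
    simp_rw [indicator_conv_mul_eq] at hswap
    rw [integral_indicator measurableSet_Ioo] at hswap
    rw [causalConv_eq_Ioo, hswap, causalConv_eq_Ioo, ← integral_indicator measurableSet_Ioo]
    congr 1
    ext τ
    rw [integral_mul_const]
    by_cases hτ : τ ∈ Ioo 0 t
    · rw [integral_indicator_mul_indicator f g hτ, indicator_of_mem hτ, indicator_of_mem hτ]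
    · simp [indicator_of_notMem hτ]
  · have h1 := hint.integral_prod_left
    simp_rw [indicator_conv_mul_eq] at h1
    rw [integrableOn_Ioc_iff_integrableOn_Ioo]
    exact (integrable_indicator_iff measurableSet_Ioo).1 h1

end Associativity

theorem integrableOn_comp_sub_left {k : ℝ → ℝ} {r : ℝ} (hr : 0 ≤ r)
    (hk : IntegrableOn k (Ioc 0 r)) : IntegrableOn (fun τ => k (r - τ)) (Ioc 0 r) := by
  have h := ((intervalIntegrable_iff_integrableOn_Ioc_of_le hr).2 hk).comp_sub_left r
  rw [sub_zero, sub_self] at h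
  exact (intervalIntegrable_iff_integrableOn_Ioc_of_le hr).1 h.symm

section Kernel

variable {k v : ℝ → ℝ}

theorem setIntegral_Ioc_mono_right (hk0 : ∀ t, 0 < t → 0 ≤ k t) {s t : ℝ} (hst : s ≤ t)
    (hk : IntegrableOn k (Ioc 0 t)) : ∫ τ in Ioc 0 s, k τ ≤ ∫ τ in Ioc 0 t, k τ :=
  setIntegral_mono_set hk ((ae_restrict_iff' measurableSet_Ioc).2 <|
    Eventually.of_forall fun τ hτ => hk0 τ hτ.1) (Ioc_subset_Ioc_right hst).eventuallyLE

/-- The integral from `0` of `k * v` is the convolution of `k` with the integral of `v`. -/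
theorem integral_causalConv (hk0 : ∀ t, 0 < t → 0 ≤ k t)
    (hk : ∀ T, 0 < T → IntegrableOn k (Ioc 0 T)) (hv : ∀ T, 0 < T → IntegrableOn v (Ioc 0 T))
    {t : ℝ} (ht : 0 < t) :
    IntegrableOn (causalConv k v) (Ioc 0 t) ∧
      IntegrableOn (fun s => k (t - s) * ∫ τ in Ioc 0 s, v τ) (Ioc 0 t) ∧
      ∫ s in Ioc 0 t, k (t - s) * (∫ τ in Ioc 0 s, v τ) = ∫ s in Ioc 0 t, causalConv k v s := by
  have hone : IntegrableOn (fun _ => (1 : ℝ)) (Ioc 0 t) := integrableOn_const (by simp)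
  have hbound : ∀ s ∈ Ioc 0 t, causalConv (fun _ => 1) k s ≤ ∫ τ in Ioc 0 t, k τ := by
    intro s hs
    rw [causalConv_one_left]
    exact setIntegral_Ioc_mono_right hk0 hs.2 (hk t ht)
  obtain ⟨h1, h2⟩ := causalConv_assoc_and_integrableOn (f := fun _ => 1) hone (hk t ht) (hv t ht)
    (fun _ _ => zero_le_one) hk0 (fun s hs => by simpa using hk s hs.1) hbound
  obtain ⟨h3, h4⟩ := causalConv_assoc_and_integrableOn (g := fun _ => 1) (hk t ht) hone (hv t ht)
    hk0 (fun _ _ => zero_le_one)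
    (fun s hs => by simpa using integrableOn_comp_sub_left hs.1.le (hk s hs.1))
    (fun s hs => by rw [causalConv_comm _ _ hs.1.le]; exact hbound s hs)
  simp only [one_mul, causalConv_one_left] at h2 h4
  refine ⟨h2, h4, ?_⟩
  have h5 : causalConv (causalConv k fun _ => 1) v t =
      causalConv (causalConv (fun _ => 1) k) v t := by
    refine setIntegral_congr_fun measurableSet_Ioc fun τ hτ => ?_
    simp only [causalConv_comm k (fun _ => 1) (sub_nonneg.2 hτ.2)]
  rw [h5, ← h1, causalConv_one_left] at h3
  rw [← h3]
  simp only [causalConv, one_mul]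

theorem causalConv_eq_integral {u : ℝ → ℝ} (hk0 : ∀ t, 0 < t → 0 ≤ k t)
    (hk : ∀ T, 0 < T → IntegrableOn k (Ioc 0 T)) (hv : ∀ T, 0 < T → IntegrableOn v (Ioc 0 T))
    (hu : ∀ t, 0 ≤ t → u t = u 0 + ∫ s in Ioc 0 t, v s) {r : ℝ} (hr : 0 < r) :
    causalConv k u r = ∫ s in Ioc 0 r, (k s * u 0 + causalConv k v s) := by
  obtain ⟨h1, h2, h3⟩ := integral_causalConv hk0 hk hv hr
  have hk' := integrableOn_comp_sub_left hr.le (hk r hr)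
  have hkcomm := causalConv_comm k (fun _ => 1) hr.le
  simp only [causalConv, one_mul, mul_one] at hkcomm
  calc causalConv k u r
      = ∫ s in Ioc 0 r, (k (r - s) * u 0 + k (r - s) * ∫ τ in Ioc 0 s, v τ) :=
        setIntegral_congr_fun measurableSet_Ioc fun s hs => by
          simp only [hu s hs.1.le, mul_add]
    _ = _ := by
        rw [integral_add (hk'.mul_const _) h2, integral_add ((hk r hr).mul_const _) h1, h3,
          integral_mul_const, integral_mul_const, hkcomm]

theorem ae_hasDerivAt_integral_Ioc {φ : ℝ → ℝ} (hφ : ∀ T, 0 < T → IntegrableOn φ (Ioc 0 T)) :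
    ∀ᵐ s ∂(volume.restrict (Ioi 0)), HasDerivAt (fun r => ∫ τ in Ioc 0 r, φ τ) (φ s) s := by
  rw [ae_restrict_iff' measurableSet_Ioi]
  have h : ∀ n : ℕ, ∀ᵐ s, s ∈ uIcc (0 : ℝ) (n + 1) → ∀ c ∈ uIcc (0 : ℝ) (n + 1),
      HasDerivAt (fun x => ∫ τ in c..x, φ τ) (φ s) s := fun n =>
    IntervalIntegrable.ae_hasDerivAt_integral
      ((intervalIntegrable_iff_integrableOn_Ioc_of_le (by positivity)).2 (hφ _ (by positivity)))
  filter_upwards [ae_all_iff.2 h] with s hs hs0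
  obtain ⟨n, hn⟩ := exists_nat_ge s
  have hderiv := hs n (by
    rw [uIcc_of_le (by positivity)]
    exact ⟨le_of_lt hs0, by linarith⟩) 0 left_mem_uIcc
  refine hderiv.congr_of_eventuallyEq ?_
  filter_upwards [Ioi_mem_nhds hs0] with r hr
  exact (intervalIntegral.integral_of_le (le_of_lt hr)).symm

end Kernel

/-- If `k, κ` are nonnegative locally integrable Sonine kernels
(`∫₀ᵗ k(t-τ) κ(τ) dτ = 1` for all `t > 0`) and `u` is locally absolutely continuous
on `[0,∞)` (i.e. `u(t) = u(0) + ∫₀ᵗ u'(s) ds` with `u'` locally integrable), then for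
almost every `s > 0` the derivative `D(s) = (d/ds) ∫₀ˢ k(s-τ) u(τ) dτ` exists, and
`∫₀ᵗ κ(t-s) [D(s) - k(s) u(0)] ds = u(t) - u(0)` for every `t > 0`;
that is, `(I_(k) D_(k) u)(t) = u(t) - u(0)`. -/
theorem statement1
    (k κ u u' : ℝ → ℝ)
    (hk_nonneg : ∀ t, 0 < t → 0 ≤ k t)
    (hκ_nonneg : ∀ t, 0 < t → 0 ≤ κ t)
    (hk_loc : ∀ T, 0 < T → IntegrableOn k (Set.Ioc 0 T))
    (hκ_loc : ∀ T, 0 < T → IntegrableOn κ (Set.Ioc 0 T))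
    (hSonine : ∀ t, 0 < t → ∫ τ in Set.Ioc 0 t, k (t - τ) * κ τ = 1)
    (hu'_loc : ∀ T, 0 < T → IntegrableOn u' (Set.Ioc 0 T))
    (hu_AC : ∀ t, 0 ≤ t → u t = u 0 + ∫ s in Set.Ioc 0 t, u' s) :
    ∃ D : ℝ → ℝ,
      (∀ᵐ s ∂(volume.restrict (Set.Ioi 0)),
        HasDerivAt (fun r => ∫ τ in Set.Ioc 0 r, k (r - τ) * u τ) (D s) s) ∧
      ∀ t, 0 < t →
        ∫ s in Set.Ioc 0 t, κ (t - s) * (D s - k s * u 0) = u t - u 0 := by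
  obtain hw := fun T hT => (integral_causalConv hk_nonneg hk_loc hu'_loc (t := T) hT).1
  refine ⟨fun s => k s * u 0 + causalConv k u' s, ?_, fun t ht => ?_⟩
  · filter_upwards [ae_hasDerivAt_integral_Ioc fun T hT => ((hk_loc T hT).mul_const (u 0)).add
      (hw T hT), ae_restrict_mem measurableSet_Ioi] with s hs hs0
    refine hs.congr_of_eventuallyEq ?_
    filter_upwards [Ioi_mem_nhds hs0] with r hr
    exact causalConv_eq_integral hk_nonneg hk_loc hu'_loc hu_AC hr
  · have hκk : ∀ s, 0 < s → causalConv κ k s = 1 := fun s hs => by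
      rw [causalConv_comm _ _ hs.le]
      exact hSonine s hs
    have hint : ∀ s ∈ Ioc 0 t, IntegrableOn (fun τ => κ (s - τ) * k τ) (Ioc 0 s) := by
      intro s hs
      exact Integrable.of_integral_ne_zero (ne_of_eq_of_ne (hκk s hs.1) one_ne_zero)
    have hassoc := (causalConv_assoc_and_integrableOn (hκ_loc t ht) (hk_loc t ht) (hu'_loc t ht)
      hκ_nonneg hk_nonneg hint fun s hs => (hκk s hs.1).le).1
    simp only [add_sub_cancel_left]
    rw [hu_AC t ht.le, add_sub_cancel_left]
    refine hassoc.trans ?_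
    rw [causalConv_eq_Ioo, integral_Ioc_eq_integral_Ioo]
    refine setIntegral_congr_fun measurableSet_Ioo fun τ hτ => ?_
    simp only [hκk _ (sub_pos.2 hτ.2), one_mul]
end

section
/- Suppose k satisfies assumption (*). Then there exists a locally integrable, completely monotone function κ : (0,∞) → [0,∞) of the form κ(s) = ∫_{(0,∞)} e^{−λs} η(dλ), where η is a Borel measure with ∫ (1+λ)^{−1} η(dλ) < ∞, such that ∫₀^∞ e^{−ps} κ(s) ds = 1/(p·K(p)) for all p > 0, and the Sonine relation ∫₀ᵗ k(t−τ) κ(τ) dτ = 1 holds for all t > 0. -/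
open MeasureTheory Filter Set

/-- A function `g` is completely monotone on `(0, ∞)` if it is infinitely
differentiable there and `(-1)^n * g^(n)(t) ≥ 0` for all `t > 0`, `n ≥ 0`. -/
def CompletelyMonotone (g : ℝ → ℝ) : Prop :=
  ContDiffOn ℝ (⊤ : ℕ∞) g (Set.Ioi 0) ∧
  ∀ (n : ℕ) (t : ℝ), 0 < t → 0 ≤ (-1 : ℝ) ^ n * iteratedDeriv n g t

open scoped Topology ENNReal

lemma one_add_mul_pos {z x : ℝ} (hz : -1 < z) (h0 : 0 ≤ x) (h1 : x ≤ 1) : 0 < 1 + z * x := by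
  rcases h0.eq_or_lt with rfl | h0
  · simp
  · nlinarith [mul_pos h0 (by linarith : 0 < 1 + z)]

lemma inv_one_add_mul_le {z x : ℝ} (hz : -1 < z) (h0 : 0 ≤ x) (h1 : x ≤ 1) :
    (1 + z * x)⁻¹ ≤ 1 + (1 + z)⁻¹ := by
  have h2 : 0 < 1 + z := by linarith
  rcases le_total 0 z with h | h
  · have : (1 + z * x)⁻¹ ≤ 1 := inv_le_one_of_one_le₀ (by nlinarith)
    have : 0 < (1 + z)⁻¹ := by positivity
    linarith
  · have : (1 + z * x)⁻¹ ≤ (1 + z)⁻¹ := inv_anti₀ h2 (by nlinarith)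
    linarith

/-- The spectral measure at a vector of a self-adjoint operator with values between `0` and `1`,
characterised through resolvents. -/
lemma exists_measure_integral_resolvent {H : Type*} [NormedAddCommGroup H] [InnerProductSpace ℂ H]
    [CompleteSpace H] (T : H →L[ℂ] H) (hT0 : 0 ≤ T) (hT1 : T ≤ 1) (g : H) :
    ∃ ρ : Measure ℝ, IsFiniteMeasure ρ ∧ ρ (Icc 0 1)ᶜ = 0 ∧
      ∀ z : ℝ, -1 < z → ∀ h : H, h + (z : ℂ) • T h = g →
        ∫ x, (1 + z * x)⁻¹ ∂ρ = (inner ℂ g h).re := by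
  have hsa : IsSelfAdjoint T := IsSelfAdjoint.of_nonneg hT0
  have hsub : ∀ x ∈ spectrum ℝ T, x ∈ Icc (0 : ℝ) 1 := fun x hx =>
    ⟨spectrum_nonneg_of_nonneg hT0 hx,
      (le_algebraMap_iff_spectrum_le (r := (1 : ℝ)) hsa).1 (by simpa using hT1) x hx⟩
  let Λ₀ : CompactlySupportedContinuousMap (spectrum ℝ T) ℝ →ₗ[ℝ] ℝ :=
    { toFun := fun f => (inner ℂ g (cfcHom hsa (f : C(spectrum ℝ T, ℝ)) g)).re
      map_add' := fun f₁ f₂ => by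
        have : ((f₁ + f₂ : CompactlySupportedContinuousMap (spectrum ℝ T) ℝ) :
            C(spectrum ℝ T, ℝ)) = (f₁ : C(spectrum ℝ T, ℝ)) + f₂ := rfl
        rw [this, map_add, add_apply, inner_add_right, Complex.add_re]
      map_smul' := fun c f => by
        have : ((c • f : CompactlySupportedContinuousMap (spectrum ℝ T) ℝ) :
            C(spectrum ℝ T, ℝ)) = c • (f : C(spectrum ℝ T, ℝ)) := rfl
        rw [this, map_smul, smul_apply, inner_smul_right_eq_smul,
          Complex.real_smul, Complex.re_ofReal_mul]
        simp }
  let Λ := PositiveLinearMap.mk₀ Λ₀ (by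
    intro f hf
    have h0 : 0 ≤ cfcHom hsa (f : C(spectrum ℝ T, ℝ)) := (cfcHom_nonneg_iff hsa).2 hf
    rw [ContinuousLinearMap.nonneg_iff_isPositive] at h0
    exact (Complex.nonneg_iff.1 (h0.inner_nonneg_right g)).1)
  have hΛ : ∀ f : C(spectrum ℝ T, ℝ),
      ∫ x, f x ∂(RealRMK.rieszMeasure Λ) = (inner ℂ g (cfcHom hsa f g)).re := fun f =>
    RealRMK.integral_rieszMeasure Λ (CompactlySupportedContinuousMap.continuousMapEquiv f)
  have hfin : IsFiniteMeasure (RealRMK.rieszMeasure Λ) := inferInstance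
  refine ⟨(RealRMK.rieszMeasure Λ).map Subtype.val, inferInstance, ?_, ?_⟩
  · rw [Measure.map_apply measurable_subtype_coe measurableSet_Icc.compl]
    convert measure_empty (μ := RealRMK.rieszMeasure Λ)
    ext x
    simpa using hsub x x.2
  · intro z hz h hh
    have hpos : ∀ x ∈ spectrum ℝ T, 0 < 1 + z * x := by
      intro x hx
      obtain ⟨h0, h1⟩ := hsub x hx
      exact one_add_mul_pos hz h0 h1
    rw [integral_map measurable_subtype_coe.aemeasurable
      (by fun_prop : Measurable fun x : ℝ => (1 + z * x)⁻¹).aestronglyMeasurable]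
    let f : C(spectrum ℝ T, ℝ) := ⟨fun x => (1 + z * (x : ℝ))⁻¹,
      Continuous.inv₀ (by fun_prop) fun x => (hpos x x.2).ne'⟩
    let q : C(spectrum ℝ T, ℝ) := (1 : C(spectrum ℝ T, ℝ)) +
      z • (ContinuousMap.id ℝ).restrict (spectrum ℝ T)
    have hfq : f * q = 1 := by
      ext x
      have := (hpos x x.2).ne'
      simp [f, q, this]
    have hq : cfcHom hsa q = 1 + z • T := by
      simp only [q, map_add, map_one, map_smul]
      rw [cfcHom_id hsa]
    have key : cfcHom hsa f g = h := by
      have h1 : cfcHom hsa f * (1 + z • T) = 1 := by rw [← hq, ← map_mul, hfq, map_one]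
      have h2 := congrArg (fun A : H →L[ℂ] H => A h) h1
      simp only [mul_apply_eq_comp, add_apply,
        one_apply_eq_self, smul_apply] at h2
      rw [← h2, ← hh]
      simp
    rw [← key, ← hΛ f]
    rfl

open InnerProductSpace in
/-- For a self-adjoint contraction `S` and a unit vector `e`, the operator
`1 - S (1 - |e⟩⟨e|) S` lies between `0` and `1`. -/
lemma one_sub_sq_add_rankOne_mem_Icc {H : Type*} [NormedAddCommGroup H] [InnerProductSpace ℂ H]
    [CompleteSpace H] (S : H →L[ℂ] H) (hS : IsSelfAdjoint S) (hS1 : ‖S‖ ≤ 1) (e : H)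
    (he : ‖e‖ = 1) :
    1 - S * S + rankOne ℂ (S e) (S e) ∈ Icc (0 : H →L[ℂ] H) 1 := by
  have hsym : ∀ x y, inner ℂ (S x) y = inner ℂ x (S y) := fun x y => hS.isSymmetric x y
  have hSS : IsSelfAdjoint (S * S) := by
    simpa [hS.star_eq] using IsSelfAdjoint.mul_star_self S
  have hR : IsSelfAdjoint (rankOne ℂ (S e) (S e)) :=
    (isPositive_rankOne_self (𝕜 := ℂ) (S e)).isSelfAdjoint
  have hSSx (x : H) : (inner ℂ (S (S x)) x).re = ‖S x‖ ^ 2 := by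
    rw [hsym]
    exact inner_self_eq_norm_sq (𝕜 := ℂ) (S x)
  have hRx (x : H) : (inner ℂ (inner ℂ (S e) x • S e) x).re = ‖inner ℂ e (S x)‖ ^ 2 := by
    rw [inner_smul_left, hsym, RCLike.conj_mul]
    norm_cast
  have hx (x : H) : (inner ℂ x x).re = ‖x‖ ^ 2 := inner_self_eq_norm_sq (𝕜 := ℂ) x
  constructor
  · refine add_nonneg ?_ ?_
    · rw [ContinuousLinearMap.nonneg_iff_isPositive, ContinuousLinearMap.isPositive_def']
      refine ⟨(IsSelfAdjoint.one _).sub hSS, fun x => ?_⟩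
      have h1 : ‖S x‖ ≤ ‖x‖ := (S.le_opNorm x).trans (by nlinarith [norm_nonneg x])
      change 0 ≤ (inner ℂ (x - S (S x)) x).re
      rw [inner_sub_left, Complex.sub_re, hSSx, hx, sub_nonneg]
      exact pow_le_pow_left₀ (norm_nonneg _) h1 2
    · rw [ContinuousLinearMap.nonneg_iff_isPositive]
      exact isPositive_rankOne_self _
  · rw [ContinuousLinearMap.le_def, ContinuousLinearMap.isPositive_def']
    refine ⟨(IsSelfAdjoint.one _).sub (((IsSelfAdjoint.one _).sub hSS).add hR), fun x => ?_⟩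
    have hcs : ‖inner ℂ e (S x)‖ ≤ ‖S x‖ := by simpa [he] using norm_inner_le_norm (𝕜 := ℂ) e (S x)
    change 0 ≤ (inner ℂ (x - (x - S (S x) + inner ℂ (S e) x • S e)) x).re
    rw [inner_sub_left, inner_add_left, inner_sub_left, Complex.sub_re, Complex.add_re,
      Complex.sub_re, hSSx, hRx, hx]
    have := pow_le_pow_left₀ (norm_nonneg _) hcs 2
    linarith

/-- Multiplication by a real function bounded by `1` is a self-adjoint contraction of `L²`. -/
lemma exists_mul_contraction {Ω : Type*} [MeasurableSpace Ω] (μ : Measure Ω) (s : Ω → ℝ)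
    (hs : Measurable s) (hs1 : ∀ᵐ x ∂μ, |s x| ≤ 1) :
    ∃ S : Lp ℂ 2 μ →L[ℂ] Lp ℂ 2 μ, IsSelfAdjoint S ∧ ‖S‖ ≤ 1 ∧
      ∀ f : Lp ℂ 2 μ, S f =ᵐ[μ] fun x => (s x : ℂ) * f x := by
  have hm : MemLp (fun x => (s x : ℂ)) ⊤ μ :=
    memLp_top_of_bound (by fun_prop) 1 (by simpa using hs1)
  let S : Lp ℂ 2 μ →L[ℂ] Lp ℂ 2 μ :=
    (ContinuousLinearMap.mul ℂ ℂ).holderL μ ⊤ 2 2 (hm.toLp _)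
  have hS : ∀ f : Lp ℂ 2 μ, S f =ᵐ[μ] fun x => (s x : ℂ) * f x := by
    intro f
    have h1 := ContinuousLinearMap.coeFn_holder (r := 2) (ContinuousLinearMap.mul ℂ ℂ)
      (hm.toLp _) f
    filter_upwards [h1, hm.coeFn_toLp] with x h1 h2
    have h3 : (S f) x = (ContinuousLinearMap.mul ℂ ℂ) ((hm.toLp _ : Lp ℂ ⊤ μ) x) (f x) := h1
    rw [h3, h2]
    rfl
  refine ⟨S, ?_, ?_, hS⟩
  · rw [ContinuousLinearMap.isSelfAdjoint_iff_isSymmetric]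
    intro f g
    change inner ℂ (S f) g = inner ℂ f (S g)
    rw [L2.inner_def, L2.inner_def]
    refine integral_congr_ae ?_
    filter_upwards [hS f, hS g] with x h1 h2
    rw [h1, h2]
    simp
    ring
  · refine ContinuousLinearMap.opNorm_le_bound _ zero_le_one fun f => ?_
    rw [one_mul]
    refine Lp.norm_le_norm_of_ae_le ?_
    filter_upwards [hS f, hs1] with x h1 h2
    rw [h1, norm_mul, Complex.norm_real]
    exact mul_le_of_le_one_left (norm_nonneg _) h2

/-- If `r z = ∫ (1 - u) / (1 + z u) dμ(u)` for a probability measure `μ` on `[0, 1]`, then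
`r z / (1 + z r z)` is a resolvent transform of a finite measure on `[0, 1]`. -/
lemma exists_measure_rankOne_perturbation (μ : Measure ℝ) [IsProbabilityMeasure μ]
    (hμ : ∀ᵐ u ∂μ, u ∈ Icc (0 : ℝ) 1) :
    ∃ ρ : Measure ℝ, IsFiniteMeasure ρ ∧ ρ (Icc 0 1)ᶜ = 0 ∧
      ∀ z : ℝ, -1 < z → (∫ x, (1 + z * x)⁻¹ ∂ρ) * (1 + z * ∫ u, (1 - u) * (1 + z * u)⁻¹ ∂μ) =
        ∫ u, (1 - u) * (1 + z * u)⁻¹ ∂μ := by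
  have hbound : ∀ᵐ u ∂μ, |√(1 - u)| ≤ 1 := by
    filter_upwards [hμ] with u hu
    rw [abs_of_nonneg (Real.sqrt_nonneg _)]
    exact Real.sqrt_le_one.2 (by linarith [hu.1])
  obtain ⟨S, hSa, hS1, hS⟩ := exists_mul_contraction μ (fun u => √(1 - u)) (by fun_prop) hbound
  let e : Lp ℂ 2 μ := (memLp_const (1 : ℂ)).toLp _
  have he : e =ᵐ[μ] fun _ => (1 : ℂ) := MemLp.coeFn_toLp _
  have hen : ‖e‖ = 1 := by
    rw [Lp.norm_toLp]
    simp [eLpNorm_const (1 : ℂ) two_ne_zero (IsProbabilityMeasure.ne_zero μ)]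
  have hSe : S e =ᵐ[μ] fun u => (√(1 - u) : ℂ) := by
    filter_upwards [hS e, he] with u h1 h2
    rw [h1, h2, mul_one]
  obtain ⟨hT0, hT1⟩ := one_sub_sq_add_rankOne_mem_Icc S hSa hS1 e hen
  obtain ⟨ρ, hρ, hρs, hρi⟩ := exists_measure_integral_resolvent _ hT0 hT1 (S e)
  refine ⟨ρ, hρ, hρs, fun z hz => ?_⟩
  have hw : MemLp (fun u : ℝ => (((1 + z * u)⁻¹ : ℝ) : ℂ)) 2 μ := by
    refine MemLp.of_bound (by fun_prop) (1 + (1 + z)⁻¹) ?_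
    filter_upwards [hμ] with u hu
    rw [Complex.norm_real, Real.norm_of_nonneg (inv_pos.2 (one_add_mul_pos hz hu.1 hu.2)).le]
    exact inv_one_add_mul_le hz hu.1 hu.2
  let w : Lp ℂ 2 μ := hw.toLp _
  have hw' : w =ᵐ[μ] fun u : ℝ => (((1 + z * u)⁻¹ : ℝ) : ℂ) := hw.coeFn_toLp
  set r := ∫ u, (1 - u) * (1 + z * u)⁻¹ ∂μ with hr
  have hin : inner ℂ (S e) (S w) = (r : ℂ) := by
    rw [L2.inner_def, hr, ← integral_complex_ofReal]
    refine integral_congr_ae ?_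
    filter_upwards [hSe, hS w, hw', hμ] with u h1 h2 h3 hu
    rw [h1, h2, h3]
    have : √(1 - u) * √(1 - u) = 1 - u := Real.mul_self_sqrt (by linarith [hu.2])
    simp only [RCLike.inner_apply, Complex.conj_ofReal]
    norm_cast
    linear_combination (1 + z * u)⁻¹ * this
  have hres : S w + (z : ℂ) • (1 - S * S + InnerProductSpace.rankOne ℂ (S e) (S e)) (S w)
      = ((1 + z * r : ℝ) : ℂ) • S e := by
    have h0 : (1 - S * S + InnerProductSpace.rankOne ℂ (S e) (S e)) (S w)
        = S w - S (S (S w)) + (r : ℂ) • S e := by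
      rw [← hin]
      rfl
    have h1 : S w + (z : ℂ) • (S w - S (S (S w))) = S e := by
      refine Lp.ext ?_
      filter_upwards [hSe, hS w, hw', hμ, hS (S w), hS (S (S w)),
        Lp.coeFn_add (S w) ((z : ℂ) • (S w - S (S (S w)))),
        Lp.coeFn_smul (z : ℂ) (S w - S (S (S w))), Lp.coeFn_sub (S w) (S (S (S w)))]
        with u h1 h2 h3 hu h4 h5 h6 h7 h8
      rw [h6, Pi.add_apply, h7, Pi.smul_apply, h8, Pi.sub_apply, h5, h4, h2, h1, h3]
      have hsq : √(1 - u) * √(1 - u) = 1 - u := Real.mul_self_sqrt (by linarith [hu.2])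
      have hne := (one_add_mul_pos hz hu.1 hu.2).ne'
      rw [smul_eq_mul]
      norm_cast
      linear_combination √(1 - u) * mul_inv_cancel₀ hne
        - z * √(1 - u) * (1 + z * u)⁻¹ * hsq
    rw [h0, smul_add, ← add_assoc, h1]
    push_cast
    rw [add_smul, one_smul, smul_smul]
  have hr_mem : ∀ᵐ u ∂μ, 0 ≤ (1 - u) * (1 + z * u)⁻¹ ∧ (1 - u) * (1 + z * u)⁻¹ ≤ 1 := by
    filter_upwards [hμ] with u hu
    have := one_add_mul_pos hz hu.1 hu.2
    refine ⟨mul_nonneg (by linarith [hu.2]) (by positivity), ?_⟩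
    rw [← div_eq_mul_inv, div_le_one this]
    nlinarith [hu.1]
  have hr0 : 0 ≤ r := integral_nonneg_of_ae (hr_mem.mono fun u h => h.1)
  have hr1 : r ≤ 1 := by
    simpa using integral_mono_of_nonneg (hr_mem.mono fun u h => h.1)
      (integrable_const (1 : ℝ)) (hr_mem.mono fun u h => h.2)
  have hpos : 0 < 1 + z * r := one_add_mul_pos hz hr0 hr1
  rw [hρi z hz (((1 + z * r : ℝ) : ℂ)⁻¹ • S w) ?_, inner_smul_right, hin]
  · norm_cast
    field_simp
  · have hne : ((1 + z * r : ℝ) : ℂ) ≠ 0 := by exact_mod_cast hpos.ne'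
    rw [map_smul, smul_comm (z : ℂ), ← smul_add, hres, smul_smul, inv_mul_cancel₀ hne, one_smul]


lemma integrable_inv_one_add_mul {ρ : Measure ℝ} [IsFiniteMeasure ρ]
    (hρ : ∀ᵐ x ∂ρ, x ∈ Icc (0 : ℝ) 1) {z : ℝ} (hz : -1 < z) :
    Integrable (fun x => (1 + z * x)⁻¹) ρ := by
  refine Integrable.of_bound (by fun_prop) (1 + (1 + z)⁻¹) ?_
  filter_upwards [hρ] with x hx
  rw [Real.norm_of_nonneg (inv_pos.2 (one_add_mul_pos hz hx.1 hx.2)).le]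
  exact inv_one_add_mul_le hz hx.1 hx.2

/-- A function of the form `1 - (p - 1) ∫ (1 + (p - 1) x)⁻¹ dρ(x)`, with `ρ` a finite measure on
`[0, 1]`, which vanishes at infinity and is `o(1 / p)` at `0`, is the Stieltjes transform of a
measure on `(0, ∞)`. -/
lemma exists_stieltjes_measure (ρ : Measure ℝ) [IsFiniteMeasure ρ]
    (hρ : ∀ᵐ x ∂ρ, x ∈ Icc (0 : ℝ) 1) (G : ℝ → ℝ)
    (hG : ∀ p, 0 < p → G p = 1 - (p - 1) * ∫ x, (1 + (p - 1) * x)⁻¹ ∂ρ)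
    (hG_inf : Tendsto G atTop (𝓝 0))
    (hG_zero : Tendsto (fun p => p * G p) (𝓝[>] 0) (𝓝 0)) :
    ∃ η : Measure ℝ, (∀ᵐ l ∂η, 0 < l) ∧ Integrable (fun l => (1 + l)⁻¹) η ∧
      ∀ p, 0 < p → ∫ l, (p + l)⁻¹ ∂η = G p := by
  have hone : ∫⁻ x, (ENNReal.ofReal x)⁻¹ ∂ρ = 1 := by
    have h1 : Tendsto (fun n : ℕ => ∫⁻ x, ENNReal.ofReal (n * (1 + n * x)⁻¹) ∂ρ) atTop
        (𝓝 (∫⁻ x, (ENNReal.ofReal x)⁻¹ ∂ρ)) := by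
      refine lintegral_tendsto_of_tendsto_of_monotone (fun n => by fun_prop) ?_ ?_
      · filter_upwards [hρ] with x hx m n hmn
        have h0 : (m : ℝ) ≤ n := by exact_mod_cast hmn
        have hm : (0 : ℝ) ≤ m := m.cast_nonneg
        refine ENNReal.ofReal_le_ofReal ?_
        have := hx.1
        rw [← div_eq_mul_inv, ← div_eq_mul_inv, div_le_div_iff₀ (by positivity) (by positivity)]
        nlinarith
      · filter_upwards [hρ] with x hx
        rcases hx.1.eq_or_lt with rfl | h0
        · simpa using ENNReal.tendsto_nat_nhds_top
        · rw [← ENNReal.ofReal_inv_of_pos h0]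
          refine ENNReal.tendsto_ofReal ?_
          have h2 : Tendsto (fun n : ℕ => ((n : ℝ)⁻¹ + x)⁻¹) atTop (𝓝 (0 + x)⁻¹) :=
            ((tendsto_inv_atTop_zero.comp tendsto_natCast_atTop_atTop).add_const x).inv₀
              (by simpa using h0.ne')
          rw [zero_add] at h2
          refine h2.congr' ?_
          filter_upwards [eventually_gt_atTop 0] with n hn
          have : (0 : ℝ) < n := by exact_mod_cast hn
          field_simp
    have h2 : Tendsto (fun n : ℕ => ∫⁻ x, ENNReal.ofReal (n * (1 + n * x)⁻¹) ∂ρ) atTop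
        (𝓝 (ENNReal.ofReal (1 - 0))) := by
      have h3 : Tendsto (fun n : ℕ => ENNReal.ofReal (1 - G (n + 1))) atTop
          (𝓝 (ENNReal.ofReal (1 - 0))) := by
        refine ENNReal.tendsto_ofReal (tendsto_const_nhds.sub (hG_inf.comp ?_))
        exact tendsto_atTop_add_const_right _ _ tendsto_natCast_atTop_atTop
      refine h3.congr fun n => ?_
      have hn : (-1 : ℝ) < n := by linarith [n.cast_nonneg (α := ℝ)]
      rw [← ofReal_integral_eq_lintegral_ofReal ((integrable_inv_one_add_mul hρ hn).const_mul _),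
        integral_const_mul, hG (n + 1) (by positivity)]
      · simp
      · filter_upwards [hρ] with x hx
        have := one_add_mul_pos hn hx.1 hx.2
        have := n.cast_nonneg (α := ℝ)
        positivity
    simpa using tendsto_nhds_unique h1 h2
  have hpos : ∀ᵐ x ∂ρ, 0 < x := by
    have := ae_lt_top (by fun_prop) (hone ▸ ENNReal.one_ne_top)
    filter_upwards [this] with x hx
    simpa using hx
  have hint_inv : Integrable (fun x => x⁻¹) ρ := by
    refine ⟨by fun_prop, ?_⟩
    rw [hasFiniteIntegral_iff_ofReal (hpos.mono fun x hx => (inv_pos.2 hx).le)]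
    refine lt_of_eq_of_lt (lintegral_congr_ae ?_) (hone ▸ ENNReal.one_lt_top)
    filter_upwards [hpos] with x hx using ENNReal.ofReal_inv_of_pos hx
  have hone' : ∫ x, x⁻¹ ∂ρ = 1 := by
    rw [integral_eq_lintegral_of_nonneg_ae (hpos.mono fun x hx => (inv_pos.2 hx).le)
      (by fun_prop)]
    rw [lintegral_congr_ae (hpos.mono fun x hx => ENNReal.ofReal_inv_of_pos hx), hone]
    simp
  have hint (p : ℝ) (hp : 0 < p) : Integrable (fun x => x⁻¹ * (1 + (p - 1) * x)⁻¹) ρ ∧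
      ∫ x, x⁻¹ * (1 + (p - 1) * x)⁻¹ ∂ρ = G p := by
    have hz : -1 < p - 1 := by linarith
    have h1 : (fun x => x⁻¹ - (p - 1) * (1 + (p - 1) * x)⁻¹) =ᵐ[ρ]
        fun x => x⁻¹ * (1 + (p - 1) * x)⁻¹ := by
      filter_upwards [hρ, hpos] with x hx hx0
      have := (one_add_mul_pos hz hx.1 hx.2).ne'
      linear_combination -x⁻¹ * mul_inv_cancel₀ this
        + (p - 1) * (1 + (p - 1) * x)⁻¹ * inv_mul_cancel₀ hx0.ne'
    have h2 := (integrable_inv_one_add_mul hρ hz).const_mul (p - 1)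
    refine ⟨(hint_inv.sub h2).congr h1, ?_⟩
    rw [← integral_congr_ae h1, integral_sub hint_inv h2, hone', integral_const_mul, hG p hp]
  have hatom : ρ {1} = 0 := by
    have h1 : ∀ p, 0 < p → ρ.real {1} ≤ p * G p := by
      intro p hp
      rw [← (hint p hp).2, ← integral_const_mul]
      calc ρ.real {1} = ∫ x in {1}, p * (x⁻¹ * (1 + (p - 1) * x)⁻¹) ∂ρ := by
            rw [integral_singleton]
            have : p * ((1 : ℝ)⁻¹ * (1 + (p - 1) * 1)⁻¹) = 1 := by
              simp [hp.ne']
            rw [this]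
            simp
        _ ≤ _ := by
            refine setIntegral_le_integral ((hint p hp).1.const_mul p) ?_
            filter_upwards [hρ] with x hx
            have := one_add_mul_pos (by linarith : -1 < p - 1) hx.1 hx.2
            have := hx.1
            positivity
    have h2 : ρ.real {1} ≤ 0 := ge_of_tendsto hG_zero
      (eventually_mem_nhdsWithin.mono fun p hp => h1 p hp)
    exact (measureReal_eq_zero_iff).1 (le_antisymm h2 measureReal_nonneg)
  have hlt : ∀ᵐ x ∂ρ, x < 1 := by
    have : ∀ᵐ x ∂ρ, x ∉ ({1} : Set ℝ) := measure_eq_zero_iff_ae_notMem.1 hatom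
    filter_upwards [hρ, this] with x hx h1
    exact lt_of_le_of_ne hx.2 h1
  let d : ℝ → ℝ≥0∞ := fun x => ENNReal.ofReal (x⁻¹ ^ 2)
  have hφ : Measurable fun x : ℝ => x⁻¹ - 1 := by fun_prop
  have hd : Measurable d := by fun_prop
  have hd_top : ∀ᵐ x ∂ρ, d x < ∞ := ae_of_all _ fun x => ENNReal.ofReal_lt_top
  have heq (p : ℝ) (hp : 0 < p) : (fun x => (d x).toReal • (p + (x⁻¹ - 1))⁻¹) =ᵐ[ρ]
      fun x => x⁻¹ * (1 + (p - 1) * x)⁻¹ := by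
    filter_upwards [hρ, hpos] with x hx hx0
    have := (one_add_mul_pos (by linarith : -1 < p - 1) hx.1 hx.2).ne'
    have h2 : p + (x⁻¹ - 1) = (1 + (p - 1) * x) * x⁻¹ := by
      field_simp
      ring
    rw [h2, ENNReal.toReal_ofReal (by positivity), smul_eq_mul]
    field_simp
  refine ⟨(ρ.withDensity d).map (fun x => x⁻¹ - 1), ?_, ?_, fun p hp => ?_⟩
  · rw [ae_map_iff hφ.aemeasurable measurableSet_Ioi]
    refine (withDensity_absolutelyContinuous ρ d).ae_le ?_
    filter_upwards [hpos, hlt] with x h0 h1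
    have := (one_lt_inv₀ h0).2 h1
    linarith
  · rw [integrable_map_measure (by fun_prop) hφ.aemeasurable,
      integrable_withDensity_iff_integrable_smul' hd hd_top]
    exact (hint 1 one_pos).1.congr (heq 1 one_pos).symm
  · rw [integral_map hφ.aemeasurable (by fun_prop),
      integral_withDensity_eq_integral_toReal_smul hd hd_top, integral_congr_ae (heq p hp),
      (hint p hp).2]

/-- If `K` is the Stieltjes transform of a measure on `[0, ∞)`, unbounded at `0` and with `p K(p)`
unbounded at infinity, then `1 / (p K(p))` is the Stieltjes transform of a measure on `(0, ∞)`. -/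
lemma exists_stieltjes_measure_inv (m : Measure ℝ) (hm : ∀ᵐ t ∂m, 0 ≤ t)
    (hm_int : Integrable (fun t => (1 + t)⁻¹) m) (K : ℝ → ℝ)
    (hK : ∀ p, 0 < p → K p = ∫ t, (p + t)⁻¹ ∂m)
    (hK_zero : Tendsto K (𝓝[>] 0) atTop)
    (hpK_inf : Tendsto (fun p => p * K p) atTop atTop) :
    ∃ η : Measure ℝ, (∀ᵐ l ∂η, 0 < l) ∧ Integrable (fun l => (1 + l)⁻¹) η ∧
      ∀ p, 0 < p → ∫ l, (p + l)⁻¹ ∂η = (p * K p)⁻¹ := by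
  have hinv_nonneg : 0 ≤ᵐ[m] fun t => (1 + t)⁻¹ := by
    filter_upwards [hm] with t ht
    have : 0 < 1 + t := by linarith
    exact (inv_pos.2 this).le
  have hM : 0 < K 1 := by
    rw [hK 1 one_pos]
    refine (integral_nonneg_of_ae hinv_nonneg).lt_of_ne fun h => ?_
    have h0 := (integral_eq_zero_iff_of_nonneg_ae hinv_nonneg hm_int).1 h.symm
    have hfalse : ∀ᵐ t ∂m, False := by
      filter_upwards [h0, hm] with t h1 h2
      have : 0 < 1 + t := by linarith
      exact (inv_pos.2 this).ne' h1
    have hm0 : m = 0 := by simpa [ae_iff] using hfalse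
    obtain ⟨p, hp1, hp2⟩ := ((hK_zero.eventually_gt_atTop 0).and eventually_mem_nhdsWithin).exists
    rw [hK p hp2, hm0, integral_zero_measure] at hp1
    exact hp1.false
  set M := K 1 with hM_def
  let d : ℝ → ℝ≥0∞ := fun t => ENNReal.ofReal (M⁻¹ * (1 + t)⁻¹)
  have hd : Measurable d := by fun_prop
  have hd_top : ∀ᵐ t ∂m, d t < ∞ := ae_of_all _ fun t => ENNReal.ofReal_lt_top
  have hφ : Measurable fun t : ℝ => (1 + t)⁻¹ := by fun_prop
  let μ := (m.withDensity d).map (fun t => (1 + t)⁻¹)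
  have hμ_prob : IsProbabilityMeasure μ := by
    constructor
    rw [Measure.map_apply hφ MeasurableSet.univ, preimage_univ, withDensity_apply _ .univ,
      Measure.restrict_univ, ← ofReal_integral_eq_lintegral_ofReal (hm_int.const_mul _),
      integral_const_mul, ← hK 1 one_pos, inv_mul_cancel₀ hM.ne', ENNReal.ofReal_one]
    filter_upwards [hinv_nonneg] with t ht using mul_nonneg (inv_pos.2 hM).le ht
  have hμ : ∀ᵐ u ∂μ, u ∈ Icc (0 : ℝ) 1 := by
    refine (ae_map_iff hφ.aemeasurable measurableSet_Icc).2 ?_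
    refine (withDensity_absolutelyContinuous m d).ae_le ?_
    filter_upwards [hm, hinv_nonneg] with t ht h0
    exact ⟨h0, inv_le_one_of_one_le₀ (by linarith)⟩
  have hμK (p : ℝ) (hp : 0 < p) : ∫ u, (1 + (p - 1) * u)⁻¹ ∂μ = K p / M := by
    rw [integral_map hφ.aemeasurable (by fun_prop),
      integral_withDensity_eq_integral_toReal_smul hd hd_top, div_eq_inv_mul, hK p hp,
      ← integral_const_mul]
    refine integral_congr_ae ?_
    filter_upwards [hm] with t ht
    have h1 : 0 < 1 + t := by linarith
    have h2 : 0 < p + t := by linarith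
    have h3 : 1 + (p - 1) * (1 + t)⁻¹ = (p + t) * (1 + t)⁻¹ := by
      field_simp
      ring
    rw [ENNReal.toReal_ofReal (by positivity), smul_eq_mul, h3]
    field_simp
  have hμr (p : ℝ) (hp : 0 < p) :
      1 + (p - 1) * ∫ u, (1 - u) * (1 + (p - 1) * u)⁻¹ ∂μ = p * K p / M := by
    have hz : -1 < p - 1 := by linarith
    have hi := integrable_inv_one_add_mul hμ hz
    have h1 : (fun u => p * (1 + (p - 1) * u)⁻¹ - 1) =ᵐ[μ]
        fun u => (p - 1) * ((1 - u) * (1 + (p - 1) * u)⁻¹) := by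
      filter_upwards [hμ] with u hu
      linear_combination mul_inv_cancel₀ (one_add_mul_pos hz hu.1 hu.2).ne'
    rw [← integral_const_mul, ← integral_congr_ae h1,
      integral_sub (hi.const_mul p) (integrable_const 1), integral_const_mul, hμK p hp]
    simp
    ring
  obtain ⟨ρ, hρ, hρs, hρr⟩ := exists_measure_rankOne_perturbation μ hμ
  have hG (p : ℝ) (hp : 0 < p) :
      (p * K p / M)⁻¹ = 1 - (p - 1) * ∫ x, (1 + (p - 1) * x)⁻¹ ∂ρ := by
    have h1 := hρr (p - 1) (by linarith)
    rw [hμr p hp] at h1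
    have h2 := hμr p hp
    have h3 : p * K p / M ≠ 0 := by
      intro h0
      rw [h0, mul_zero] at h1
      rw [h0, ← h1] at h2
      simp at h2
    refine inv_eq_of_mul_eq_one_right ?_
    linear_combination -h2 - (p - 1) * h1
  have hG_zero : Tendsto (fun p => p * (p * K p / M)⁻¹) (𝓝[>] 0) (𝓝 0) := by
    refine (hK_zero.atTop_div_const hM).inv_tendsto_atTop.congr' ?_
    filter_upwards [eventually_mem_nhdsWithin] with p hp
    have hp' : p ≠ 0 := ne_of_gt hp
    simp only [Pi.inv_apply, inv_div]
    field_simp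
  obtain ⟨η, hη0, hη1, hη⟩ := exists_stieltjes_measure ρ (ae_iff.2 hρs)
    (fun p => (p * K p / M)⁻¹) hG (hpK_inf.atTop_div_const hM).inv_tendsto_atTop hG_zero
  refine ⟨ENNReal.ofReal M⁻¹ • η, Measure.ae_smul_measure hη0 _,
    hη1.smul_measure ENNReal.ofReal_ne_top, fun p hp => ?_⟩
  rw [integral_smul_measure, hη p hp, ENNReal.toReal_ofReal (inv_pos.2 hM).le, smul_eq_mul,
    inv_div, ← mul_div_assoc, inv_mul_cancel₀ hM.ne', one_div]

section LaplaceTransform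

variable {m : Measure ℝ}

lemma sFinite_of_integrable_inv_one_add (hm : ∀ᵐ l ∂m, 0 ≤ l)
    (hm_int : Integrable (fun l => (1 + l)⁻¹) m) : SFinite m := by
  have hfin : IsFiniteMeasure (m.withDensity fun l => ENNReal.ofReal (1 + l)⁻¹) :=
    isFiniteMeasure_withDensity_ofReal hm_int.2
  rw [← withDensity_inv_same (μ := m) (f := fun l => ENNReal.ofReal (1 + l)⁻¹) (by fun_prop)
    ?_ (ae_of_all _ fun l => ENNReal.ofReal_ne_top)]
  · infer_instance
  · filter_upwards [hm] with l hl
    have : 0 < 1 + l := by linarith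
    simpa using this

lemma integrable_exp_neg_mul_of_integrable_inv_one_add (hm : ∀ᵐ l ∂m, 0 ≤ l)
    (hm_int : Integrable (fun l => (1 + l)⁻¹) m) {s : ℝ} (hs : 0 < s) :
    Integrable (fun l => Real.exp (-l * s)) m := by
  refine (hm_int.const_mul (1 + s⁻¹)).mono' (by fun_prop) ?_
  filter_upwards [hm] with l hl
  have h1 : 0 < 1 + l * s := by positivity
  have h2 : 1 + l * s ≤ Real.exp (l * s) := by linarith [Real.add_one_le_exp (l * s)]
  rw [Real.norm_of_nonneg (Real.exp_pos _).le, neg_mul, Real.exp_neg]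
  refine (inv_anti₀ h1 h2).trans ?_
  rw [← div_eq_mul_inv, inv_eq_one_div, div_le_div_iff₀ h1 (by positivity)]
  have : (1 + s⁻¹) * (1 + l * s) = 1 + l + (s⁻¹ + l * s) + l * (s⁻¹ * s - 1) := by ring
  rw [this, inv_mul_cancel₀ hs.ne']
  have := inv_pos.2 hs
  have : 0 ≤ l * s := by positivity
  linarith

lemma integral_exp_neg_mul_eq_mgf (m : Measure ℝ) :
    (fun s => ∫ l, Real.exp (-l * s) ∂m) = ProbabilityTheory.mgf (fun l => -l) m := by
  ext s
  simp only [ProbabilityTheory.mgf, mul_comm s]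

lemma mem_interior_integrableExpSet_neg (hm : ∀ᵐ l ∂m, 0 ≤ l)
    (hm_int : Integrable (fun l => (1 + l)⁻¹) m) {s : ℝ} (hs : 0 < s) :
    s ∈ interior (ProbabilityTheory.integrableExpSet (fun l => -l) m) := by
  refine interior_maximal (fun t ht => ?_) isOpen_Ioi (mem_Ioi.2 hs)
  change Integrable (fun l => Real.exp (t * -l)) m
  simpa only [mul_comm t] using integrable_exp_neg_mul_of_integrable_inv_one_add hm hm_int ht

lemma completelyMonotone_integral_exp_neg_mul (hm : ∀ᵐ l ∂m, 0 ≤ l)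
    (hm_int : Integrable (fun l => (1 + l)⁻¹) m) :
    CompletelyMonotone fun s => ∫ l, Real.exp (-l * s) ∂m := by
  rw [integral_exp_neg_mul_eq_mgf]
  have hmem := fun s (hs : 0 < s) => mem_interior_integrableExpSet_neg hm hm_int hs
  refine ⟨(ProbabilityTheory.analyticOnNhd_mgf.mono hmem).contDiffOn (uniqueDiffOn_Ioi 0),
    fun n t ht => ?_⟩
  rw [ProbabilityTheory.iteratedDeriv_mgf (hmem t ht), ← integral_const_mul]
  refine integral_nonneg_of_ae ?_
  filter_upwards [hm] with l hl
  simp only [Pi.zero_apply, ← mul_assoc, ← mul_pow, neg_mul_neg, one_mul]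
  positivity

lemma continuousOn_integral_exp_neg_mul (hm : ∀ᵐ l ∂m, 0 ≤ l)
    (hm_int : Integrable (fun l => (1 + l)⁻¹) m) :
    ContinuousOn (fun s => ∫ l, Real.exp (-l * s) ∂m) (Ioi 0) :=
  (completelyMonotone_integral_exp_neg_mul hm hm_int).1.continuousOn

lemma antitoneOn_integral_exp_neg_mul (hm : ∀ᵐ l ∂m, 0 ≤ l)
    (hm_int : Integrable (fun l => (1 + l)⁻¹) m) :
    AntitoneOn (fun s => ∫ l, Real.exp (-l * s) ∂m) (Ioi 0) := by
  intro s hs t ht hst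
  refine integral_mono_ae (integrable_exp_neg_mul_of_integrable_inv_one_add hm hm_int ht)
    (integrable_exp_neg_mul_of_integrable_inv_one_add hm hm_int hs) ?_
  filter_upwards [hm] with l hl
  exact Real.exp_le_exp.2 (by nlinarith)

lemma integral_exp_neg_mul_nonneg (m : Measure ℝ) (s : ℝ) :
    0 ≤ ∫ l, Real.exp (-l * s) ∂m :=
  integral_nonneg fun _ => (Real.exp_pos _).le

lemma laplace_integral_exp_neg_mul (hm : ∀ᵐ l ∂m, 0 ≤ l)
    (hm_int : Integrable (fun l => (1 + l)⁻¹) m) {p : ℝ} (hp : 0 < p) :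
    IntegrableOn (fun s => Real.exp (-p * s) * ∫ l, Real.exp (-l * s) ∂m) (Ioi 0) ∧
      ∫ s in Ioi 0, Real.exp (-p * s) * ∫ l, Real.exp (-l * s) ∂m = ∫ l, (p + l)⁻¹ ∂m := by
  have := sFinite_of_integrable_inv_one_add hm hm_int
  have hsec (l : ℝ) (hl : 0 ≤ l) :
      IntegrableOn (fun s => Real.exp (-p * s) * Real.exp (-l * s)) (Ioi 0) ∧
      ∫ s in Ioi 0, Real.exp (-p * s) * Real.exp (-l * s) = (p + l)⁻¹ := by
    have h1 : ∀ s, Real.exp (-p * s) * Real.exp (-l * s) = Real.exp (-(p + l) * s) := by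
      intro s
      rw [← Real.exp_add]
      congr 1
      ring
    simp only [h1]
    have h2 : -(p + l) < 0 := by linarith
    refine ⟨integrableOn_exp_mul_Ioi h2 0, ?_⟩
    rw [integral_exp_mul_Ioi h2, mul_zero, Real.exp_zero, neg_div_neg_eq, one_div]
  have hint_inv : Integrable (fun l => (p + l)⁻¹) m := by
    refine (hm_int.const_mul (1 + p⁻¹)).mono' (by fun_prop) ?_
    filter_upwards [hm] with l hl
    have h1 : 0 < p + l := by positivity
    rw [Real.norm_of_nonneg (inv_pos.2 h1).le, ← div_eq_mul_inv, inv_eq_one_div,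
      div_le_div_iff₀ h1 (by positivity)]
    have : (1 + p⁻¹) * (p + l) = 1 + l + (p + p⁻¹ * l) + (p⁻¹ * p - 1) := by ring
    rw [this, inv_mul_cancel₀ hp.ne']
    have : 0 ≤ p⁻¹ * l := by positivity
    linarith
  have hprod : Integrable (Function.uncurry fun s l => Real.exp (-p * s) * Real.exp (-l * s))
      ((volume.restrict (Ioi 0)).prod m) := by
    rw [integrable_prod_iff' (by fun_prop)]
    refine ⟨hm.mono fun l hl => (hsec l hl).1, hint_inv.congr ?_⟩
    filter_upwards [hm] with l hl
    rw [← (hsec l hl).2]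
    simp [Function.uncurry]
  simp only [← integral_const_mul]
  refine ⟨hprod.integral_prod_left, ?_⟩
  rw [integral_integral_swap hprod]
  exact integral_congr_ae (hm.mono fun l hl => (hsec l hl).2)

end LaplaceTransform

lemma IntegrableOn.of_exp_neg_mul {f : ℝ → ℝ}
    (hf : IntegrableOn (fun s => Real.exp (-1 * s) * f s) (Ioi 0)) (T : ℝ) :
    IntegrableOn f (Ioc 0 T) := by
  have h0 : Ioc 0 T ⊆ Ioi 0 := fun _ hs => hs.1
  have h1 := (hf.mono_set h0).continuousOn_mul_of_subset
    (g := fun s : ℝ => Real.exp s) (K := Icc 0 T) (by fun_prop) isCompact_Icc measurableSet_Ioc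
    Ioc_subset_Icc_self
  refine h1.congr (ae_of_all _ fun s => ?_)
  change Real.exp s * (Real.exp (-1 * s) * f s) = f s
  rw [← mul_assoc, ← Real.exp_add]
  simp

section LaplaceUniqueness

open ProbabilityTheory

lemma MeasureTheory.Measure.eq_of_eventually_mgf_eq {μ ν : Measure ℝ} [IsFiniteMeasure μ]
    [IsFiniteMeasure ν] (hμ : Iio 1 ⊆ integrableExpSet id μ) (hν : Iio 1 ⊆ integrableExpSet id ν)
    (h : ∀ᶠ x in 𝓝 (0 : ℝ), mgf id μ x = mgf id ν x) : μ = ν := by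
  have hmem {μ' : Measure ℝ} (hμ' : Iio 1 ⊆ integrableExpSet id μ') :
      AnalyticOnNhd ℂ (complexMGF id μ') {z | z.re < 1} :=
    analyticOnNhd_complexMGF.mono fun z hz => interior_maximal hμ' isOpen_Iio hz
  have heq : EqOn (complexMGF id μ) (complexMGF id ν) {z | z.re < 1} := by
    refine AnalyticOnNhd.eqOn_of_preconnected_of_frequently_eq (hmem hμ) (hmem hν)
      (convex_halfSpace_re_lt 1).isPreconnected (z₀ := 0) (by simp) ?_
    have h_real : ∃ᶠ x : ℝ in 𝓝[≠] 0, complexMGF id μ x = complexMGF id ν x := by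
      refine (h.filter_mono nhdsWithin_le_nhds).frequently.mono fun x hx => ?_
      rw [complexMGF_ofReal, complexMGF_ofReal, hx]
    have htend : Tendsto (fun x : ℝ => (x : ℂ)) (𝓝[≠] 0) (𝓝[≠] 0) := by
      refine tendsto_nhdsWithin_iff.2 ⟨?_, ?_⟩
      · exact (Complex.continuous_ofReal.tendsto' 0 0 Complex.ofReal_zero).mono_left
          nhdsWithin_le_nhds
      · filter_upwards [self_mem_nhdsWithin] with x hx
        simpa using hx
    exact htend.frequently h_real
  refine Measure.ext_of_charFun ?_
  ext t
  rw [← complexMGF_id_mul_I, ← complexMGF_id_mul_I]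
  exact heq (by simp)

lemma ae_eq_of_laplace_eq {f g : ℝ → ℝ} (hf : ∀ t, 0 < t → 0 ≤ f t) (hg : ∀ t, 0 < t → 0 ≤ g t)
    (hf_int : ∀ p, 0 < p → IntegrableOn (fun t => Real.exp (-p * t) * f t) (Ioi 0))
    (hg_int : ∀ p, 0 < p → IntegrableOn (fun t => Real.exp (-p * t) * g t) (Ioi 0))
    (h : ∀ p, 0 < p → ∫ t in Ioi 0, Real.exp (-p * t) * f t =
      ∫ t in Ioi 0, Real.exp (-p * t) * g t) :
    f =ᵐ[volume.restrict (Ioi 0)] g := by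
  set D : (ℝ → ℝ) → ℝ → ENNReal := fun φ t => ENNReal.ofReal (Real.exp (-1 * t) * φ t) with hD
  have key {φ : ℝ → ℝ} (hφ : ∀ t, 0 < t → 0 ≤ φ t)
      (hφ_int : ∀ p, 0 < p → IntegrableOn (fun t => Real.exp (-p * t) * φ t) (Ioi 0)) :
      AEMeasurable (D φ) (volume.restrict (Ioi 0)) ∧
      IsFiniteMeasure ((volume.restrict (Ioi 0)).withDensity (D φ)) ∧
      Iio 1 ⊆ integrableExpSet id ((volume.restrict (Ioi 0)).withDensity (D φ)) ∧
      ∀ x, mgf id ((volume.restrict (Ioi 0)).withDensity (D φ)) x =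
        ∫ t in Ioi 0, Real.exp (-(1 - x) * t) * φ t := by
    have hmeas : AEMeasurable (D φ) (volume.restrict (Ioi 0)) :=
      (hφ_int 1 one_pos).aemeasurable.ennreal_ofReal
    have hcongr (x : ℝ) : (fun t => (D φ t).toReal • Real.exp (x * id t))
        =ᵐ[volume.restrict (Ioi 0)] fun t => Real.exp (-(1 - x) * t) * φ t := by
      filter_upwards [ae_restrict_mem measurableSet_Ioi] with t ht
      rw [hD, ENNReal.toReal_ofReal (mul_nonneg (Real.exp_pos _).le (hφ t ht)), smul_eq_mul,
        show -(1 - x) * t = -1 * t + x * id t by simp only [id]; ring, Real.exp_add]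
      ring
    have hlt : ∀ᵐ t ∂volume.restrict (Ioi 0), D φ t < ⊤ :=
      ae_of_all _ fun t => ENNReal.ofReal_lt_top
    refine ⟨hmeas, isFiniteMeasure_withDensity_ofReal (hφ_int 1 one_pos).2, fun x hx => ?_,
      fun x => ?_⟩
    · change Integrable (fun t => Real.exp (x * id t)) _
      rw [integrable_withDensity_iff_integrable_smul₀' hmeas hlt]
      exact (hφ_int (1 - x) (sub_pos.2 hx)).congr (hcongr x).symm
    · rw [mgf, integral_withDensity_eq_integral_toReal_smul₀ hmeas hlt]
      exact integral_congr_ae (hcongr x)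
  obtain ⟨hfm, hff, hfe, hfi⟩ := key hf hf_int
  obtain ⟨hgm, hgf, hge, hgi⟩ := key hg hg_int
  have heq := Measure.eq_of_eventually_mgf_eq hfe hge (by
    filter_upwards [Iio_mem_nhds one_pos] with x hx
    rw [hfi, hgi, h _ (sub_pos.2 hx)])
  have hDD := (withDensity_eq_iff hfm hgm (by
    have := hff.measure_univ_lt_top
    rw [withDensity_apply _ MeasurableSet.univ, Measure.restrict_univ] at this
    exact this.ne)).1 heq
  filter_upwards [hDD, ae_restrict_mem measurableSet_Ioi] with t ht h0
  have h1 := (ENNReal.ofReal_eq_ofReal_iff (mul_nonneg (Real.exp_pos _).le (hf t h0))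
    (mul_nonneg (Real.exp_pos _).le (hg t h0))).1 ht
  exact mul_left_cancel₀ (Real.exp_pos _).ne' h1

end LaplaceUniqueness

lemma continuousOn_convolution_of_antitoneOn {f g : ℝ → ℝ}
    (hf : ∀ t, 0 < t → 0 ≤ f t) (hg : ∀ t, 0 < t → 0 ≤ g t)
    (hf_anti : AntitoneOn f (Ioi 0)) (hg_anti : AntitoneOn g (Ioi 0))
    (hf_cont : ContinuousOn f (Ioi 0)) (hg_cont : ContinuousOn g (Ioi 0))
    (hf_int : ∀ T, IntegrableOn f (Ioc 0 T)) (hg_int : ∀ T, IntegrableOn g (Ioc 0 T)) :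
    ContinuousOn (fun t => ∫ τ in 0..t, f τ * g (t - τ)) (Ioi 0) := by
  have hscale : EqOn (fun t => ∫ τ in 0..t, f τ * g (t - τ))
      (fun t => t * ∫ r in Ioo 0 1, f (t * r) * g (t * (1 - r))) (Ioi 0) := by
    intro t ht
    have ht' : t ≠ 0 := (mem_Ioi.1 ht).ne'
    have := intervalIntegral.integral_comp_mul_left (a := 0) (b := 1)
      (fun τ => f τ * g (t - τ)) ht'
    rw [mul_zero, mul_one, intervalIntegral.integral_of_le zero_le_one,
      integral_Ioc_eq_integral_Ioo, smul_eq_mul] at this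
    simp only [mul_sub, mul_one]
    rw [this, mul_inv_cancel_left₀ ht']
  refine ContinuousOn.congr (fun t₀ ht₀ => ContinuousAt.continuousWithinAt ?_) hscale
  have ht₀ : 0 < t₀ := ht₀
  set a := t₀ / 2
  have ha : 0 < a := half_pos ht₀
  refine continuousAt_id.mul (continuousAt_of_dominated
    (bound := fun r => f (a * r) * g (a / 2) + f (a / 2) * g (a * (1 - r))) ?_ ?_ ?_ ?_)
  · filter_upwards [Ioi_mem_nhds ht₀] with t ht
    refine ContinuousOn.aestronglyMeasurable (ContinuousOn.mul ?_ ?_) measurableSet_Ioo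
    · exact hf_cont.comp (by fun_prop) fun r hr => mul_pos ht hr.1
    · exact hg_cont.comp (by fun_prop) fun r hr => mul_pos ht (sub_pos.2 hr.2)
  · filter_upwards [Ioi_mem_nhds (half_lt_self ht₀)] with t ht
    have hat : a ≤ t := le_of_lt ht
    have ht' : 0 < t := ha.trans_le hat
    filter_upwards [ae_restrict_mem measurableSet_Ioo] with r hr
    have hr0 : 0 < r := hr.1
    have hr1 : 0 < 1 - r := sub_pos.2 hr.2
    have h1 : 0 ≤ f (t * r) := hf _ (by positivity)
    have h2 : 0 ≤ g (t * (1 - r)) := hg _ (by positivity)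
    have h3 : f (t * r) ≤ f (a * r) :=
      hf_anti (mem_Ioi.2 (by positivity)) (mem_Ioi.2 (by positivity)) (by gcongr)
    have h4 : g (t * (1 - r)) ≤ g (a * (1 - r)) :=
      hg_anti (mem_Ioi.2 (by positivity)) (mem_Ioi.2 (by positivity)) (by gcongr)
    have h5 : 0 ≤ f (a / 2) := hf _ (by positivity)
    have h6 : 0 ≤ g (a / 2) := hg _ (by positivity)
    rw [Real.norm_of_nonneg (mul_nonneg h1 h2)]
    rcases le_total r (1 / 2) with h | h
    · have h7 : g (a * (1 - r)) ≤ g (a / 2) :=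
        hg_anti (mem_Ioi.2 (by positivity)) (mem_Ioi.2 (by positivity)) (by nlinarith)
      exact (mul_le_mul h3 (h4.trans h7) h2 (h1.trans h3)).trans
        (le_add_of_nonneg_right (mul_nonneg h5 (h2.trans h4)))
    · have h7 : f (a * r) ≤ f (a / 2) :=
        hf_anti (mem_Ioi.2 (by positivity)) (mem_Ioi.2 (by positivity)) (by nlinarith)
      exact (mul_le_mul (h3.trans h7) h4 h2 h5).trans
        (le_add_of_nonneg_left (mul_nonneg (h1.trans h3) h6))
  · have key {φ : ℝ → ℝ} (hφ : ∀ T, IntegrableOn φ (Ioc 0 T)) :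
        IntervalIntegrable (fun r => φ (a * r)) volume 0 1 := by
      have :=
        ((intervalIntegrable_iff_integrableOn_Ioc_of_le ha.le).2 (hφ a)).comp_mul_left (c := a)
      simpa [ha.ne'] using this
    have hg1 := (key hg_int).comp_sub_left 1
    rw [sub_zero, sub_self] at hg1
    have := ((key hf_int).mul_const (g (a / 2))).add (hg1.symm.const_mul (f (a / 2)))
    exact (intervalIntegrable_iff_integrableOn_Ioo_of_le zero_le_one).1 this
  · filter_upwards [ae_restrict_mem measurableSet_Ioo] with r hr
    have h1 : ContinuousAt f (t₀ * r) := hf_cont.continuousAt (Ioi_mem_nhds (mul_pos ht₀ hr.1))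
    have h2 : ContinuousAt g (t₀ * (1 - r)) :=
      hg_cont.continuousAt (Ioi_mem_nhds (mul_pos ht₀ (sub_pos.2 hr.2)))
    exact (h1.comp (f := fun t => t * r) (by fun_prop)).mul
      (h2.comp (f := fun t => t * (1 - r)) (by fun_prop))

lemma laplace_convolution {f g : ℝ → ℝ} {p : ℝ}
    (hf : IntegrableOn (fun t => Real.exp (-p * t) * f t) (Ioi 0))
    (hg : IntegrableOn (fun t => Real.exp (-p * t) * g t) (Ioi 0)) :
    IntegrableOn (fun t => Real.exp (-p * t) * ∫ τ in 0..t, f τ * g (t - τ)) (Ioi 0) ∧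
      ∫ t in Ioi 0, Real.exp (-p * t) * ∫ τ in 0..t, f τ * g (t - τ) =
        (∫ t in Ioi 0, Real.exp (-p * t) * f t) * ∫ t in Ioi 0, Real.exp (-p * t) * g t := by
  have h1 (t : ℝ) : Real.exp (-p * t) * ∫ τ in 0..t, f τ * g (t - τ) =
      ∫ τ in 0..t, ContinuousLinearMap.mul ℝ ℝ (Real.exp (-p * τ) * f τ)
        (Real.exp (-p * (t - τ)) * g (t - τ)) := by
    rw [← intervalIntegral.integral_const_mul]
    congr 1 with τ
    rw [show -p * t = -p * τ + -p * (t - τ) by ring, Real.exp_add, ContinuousLinearMap.mul_apply']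
    ring
  simp only [h1]
  refine ⟨?_, integral_posConvolution hf hg (ContinuousLinearMap.mul ℝ ℝ)⟩
  refine (integrable_posConvolution hf hg (ContinuousLinearMap.mul ℝ ℝ)).integrableOn.congr_fun
    (fun t ht => ?_) measurableSet_Ioi
  exact indicator_of_mem ht _

lemma laplace_ne_zero_of_tendsto_atTop {k K : ℝ → ℝ} (hk_nonneg : ∀ t, 0 < t → 0 ≤ k t)
    (hK_int : ∀ p, 0 < p → IntegrableOn (fun t => Real.exp (-p * t) * k t) (Ioi 0))
    (hK_def : ∀ p, 0 < p → K p = ∫ t in Ioi 0, Real.exp (-p * t) * k t)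
    (hK_zero : Tendsto K (𝓝[>] 0) atTop) {p : ℝ} (hp : 0 < p) : K p ≠ 0 := by
  intro h0
  rw [hK_def p hp, integral_eq_zero_iff_of_nonneg_ae
    ((ae_restrict_mem measurableSet_Ioi).mono fun t ht =>
      mul_nonneg (Real.exp_pos _).le (hk_nonneg t ht)) (hK_int p hp)] at h0
  obtain ⟨q, hq1, hq⟩ :=
    ((hK_zero.eventually_ge_atTop 1).and self_mem_nhdsWithin).exists
  have : K q = 0 := by
    rw [hK_def q hq]
    refine integral_eq_zero_of_ae (h0.mono fun t ht => ?_)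
    have ht : Real.exp (-p * t) * k t = 0 := ht
    have hkt : k t = 0 := (mul_eq_zero.1 ht).resolve_left (Real.exp_pos _).ne'
    simp [hkt]
  linarith

/-- Under assumption (*) on `k` (Laplace transform `K` is a
Stieltjes function with `K(p) → ∞, pK(p) → 0` as `p → 0+` and
`K(p) → 0, pK(p) → ∞` as `p → ∞`), there exists a locally integrable completely
monotone kernel `κ(s) = ∫ e^{-λs} η(dλ)` whose Laplace transform is `1/(pK(p))`
and which is a Sonine partner of `k`: `∫₀ᵗ k(t-τ) κ(τ) dτ = 1` for all `t > 0`. -/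
theorem statement3
    (k K : ℝ → ℝ) (σ : MeasureTheory.Measure ℝ)
    (hk_nonneg : ∀ t, 0 < t → 0 ≤ k t)
    (hk_loc : ∀ T, 0 < T → MeasureTheory.IntegrableOn k (Set.Ioc 0 T))
    (hK_int : ∀ p, 0 < p →
      MeasureTheory.IntegrableOn (fun t => Real.exp (-p * t) * k t) (Set.Ioi 0))
    (hK_def : ∀ p, 0 < p → K p = ∫ t in Set.Ioi 0, Real.exp (-p * t) * k t)
    (hσ_int : MeasureTheory.IntegrableOn (fun t => (1 + t)⁻¹) (Set.Ici 0) σ)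
    (hK_st : ∀ p, 0 < p → K p = ∫ t in Set.Ici 0, (p + t)⁻¹ ∂σ)
    (hK_zero : Filter.Tendsto K (nhdsWithin 0 (Set.Ioi 0)) Filter.atTop)
    (hK_inf : Filter.Tendsto K Filter.atTop (nhds 0))
    (hpK_zero : Filter.Tendsto (fun p => p * K p) (nhdsWithin 0 (Set.Ioi 0)) (nhds 0))
    (hpK_inf : Filter.Tendsto (fun p => p * K p) Filter.atTop Filter.atTop) :
    ∃ (κ : ℝ → ℝ) (η : Measure ℝ),
      CompletelyMonotone κ ∧
      (∀ s, 0 < s → 0 ≤ κ s) ∧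
      (∀ T, 0 < T → IntegrableOn κ (Set.Ioc 0 T)) ∧
      IntegrableOn (fun l => (1 + l)⁻¹) (Set.Ioi 0) η ∧
      (∀ s, 0 < s → κ s = ∫ l in Set.Ioi 0, Real.exp (-l * s) ∂η) ∧
      (∀ p, 0 < p → IntegrableOn (fun s => Real.exp (-p * s) * κ s) (Set.Ioi 0)) ∧
      (∀ p, 0 < p → ∫ s in Set.Ioi 0, Real.exp (-p * s) * κ s = (p * K p)⁻¹) ∧
      (∀ t, 0 < t → ∫ τ in Set.Ioc 0 t, k (t - τ) * κ τ = 1) := by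
  set m := σ.restrict (Ici 0)
  have hm : ∀ᵐ t ∂m, 0 ≤ t := ae_restrict_mem measurableSet_Ici
  have hm_int : Integrable (fun t => (1 + t)⁻¹) m := hσ_int
  obtain ⟨η, hη, hη_int, hη_st⟩ :=
    exists_stieltjes_measure_inv m hm hm_int K hK_st hK_zero hpK_inf
  have hη_nonneg : ∀ᵐ l ∂η, 0 ≤ l := hη.mono fun _ => le_of_lt
  have hη_restrict : η.restrict (Ioi 0) = η := Measure.restrict_eq_self_of_ae_mem hη
  set κ : ℝ → ℝ := fun s => ∫ l, Real.exp (-l * s) ∂η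
  set k' : ℝ → ℝ := fun s => ∫ l, Real.exp (-l * s) ∂m
  have hκ_nonneg (s : ℝ) (_ : 0 < s) : 0 ≤ κ s := integral_exp_neg_mul_nonneg η s
  have hk'_nonneg (s : ℝ) (_ : 0 < s) : 0 ≤ k' s := integral_exp_neg_mul_nonneg m s
  have hκ_laplace (p : ℝ) (hp : 0 < p) :=
    laplace_integral_exp_neg_mul hη_nonneg hη_int hp
  have hk'_laplace (p : ℝ) (hp : 0 < p) := laplace_integral_exp_neg_mul hm hm_int hp
  have hκ_int := IntegrableOn.of_exp_neg_mul (hκ_laplace 1 one_pos).1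
  have hk'_int := IntegrableOn.of_exp_neg_mul (hk'_laplace 1 one_pos).1
  have hk_eq : k =ᵐ[volume.restrict (Ioi 0)] k' :=
    ae_eq_of_laplace_eq hk_nonneg hk'_nonneg hK_int (fun p hp => (hk'_laplace p hp).1)
      fun p hp => by rw [(hk'_laplace p hp).2, ← hK_def p hp, hK_st p hp]
  have hconv_cont : ContinuousOn (fun t => ∫ τ in 0..t, κ τ * k' (t - τ)) (Ioi 0) :=
    continuousOn_convolution_of_antitoneOn hκ_nonneg hk'_nonneg
      (antitoneOn_integral_exp_neg_mul hη_nonneg hη_int)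
      (antitoneOn_integral_exp_neg_mul hm hm_int)
      (continuousOn_integral_exp_neg_mul hη_nonneg hη_int)
      (continuousOn_integral_exp_neg_mul hm hm_int) hκ_int hk'_int
  have hconv_nonneg (t : ℝ) (ht : 0 < t) : 0 ≤ ∫ τ in 0..t, κ τ * k' (t - τ) :=
    intervalIntegral.integral_nonneg ht.le fun τ _ =>
      mul_nonneg (integral_exp_neg_mul_nonneg η τ) (integral_exp_neg_mul_nonneg m (t - τ))
  have hone (p : ℝ) (hp : 0 < p) :
      IntegrableOn (fun t => Real.exp (-p * t) * 1) (Ioi 0) ∧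
        ∫ t in Ioi 0, Real.exp (-p * t) * 1 = p⁻¹ := by
    simp only [mul_one]
    have hp' : -p < 0 := neg_neg_of_pos hp
    refine ⟨integrableOn_exp_mul_Ioi hp' 0, ?_⟩
    rw [integral_exp_mul_Ioi hp', mul_zero, Real.exp_zero, neg_div_neg_eq, one_div]
  have hconv_ae : (fun t => ∫ τ in 0..t, κ τ * k' (t - τ))
      =ᵐ[volume.restrict (Ioi 0)] fun _ => 1 := by
    refine ae_eq_of_laplace_eq hconv_nonneg (fun _ _ => zero_le_one)
      (fun p hp => (laplace_convolution (hκ_laplace p hp).1 (hk'_laplace p hp).1).1)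
      (fun p hp => (hone p hp).1) fun p hp => ?_
    rw [(laplace_convolution (hκ_laplace p hp).1 (hk'_laplace p hp).1).2, (hone p hp).2,
      (hκ_laplace p hp).2, (hk'_laplace p hp).2, hη_st p hp, ← hK_st p hp, mul_inv, mul_assoc,
      inv_mul_cancel₀ (laplace_ne_zero_of_tendsto_atTop hk_nonneg hK_int hK_def hK_zero hp),
      mul_one]
  have hconv : EqOn (fun t => ∫ τ in 0..t, κ τ * k' (t - τ)) (fun _ => 1) (Ioi 0) :=
    Measure.eqOn_open_of_ae_eq hconv_ae isOpen_Ioi hconv_cont continuousOn_const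
  refine ⟨κ, η, completelyMonotone_integral_exp_neg_mul hη_nonneg hη_int, hκ_nonneg,
    fun T _ => hκ_int T, hη_int.integrableOn, fun s _ => by rw [hη_restrict],
    fun p hp => (hκ_laplace p hp).1,
    fun p hp => (hκ_laplace p hp).2.trans (hη_st p hp), fun t ht => ?_⟩
  refine Eq.trans ?_ (hconv ht)
  change _ = ∫ τ in 0..t, κ τ * k' (t - τ)
  rw [intervalIntegral.integral_of_le ht.le, integral_Ioc_eq_integral_Ioo,
    integral_Ioc_eq_integral_Ioo]
  refine integral_congr_ae ?_
  have hk_eq' := (ae_restrict_iff' measurableSet_Ioi).1 hk_eq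
  have hsub := (quasiMeasurePreserving_sub_left_of_right_invariant volume t).ae hk_eq'
  filter_upwards [ae_restrict_of_ae hsub, ae_restrict_mem measurableSet_Ioo] with τ h hτ
  rw [h (sub_pos.2 hτ.2), mul_comm]
end

section
/- Suppose k satisfies assumption (*), with K(p) = ∫_{[0,∞)} (p+t)^{−1} σ(dt). Then σ({0}) = 0 and k(s) = ∫_{(0,∞)} e^{−ts} σ(dt) for almost every s > 0; in particular, k agrees almost everywhere with a completely monotone function, and this completely monotone version satisfies k(s) → 0 as s → ∞. -/
open MeasureTheory Filter Set

open scoped Topology ENNReal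

open ProbabilityTheory in
/-- Two finite measures on `ℝ` whose moment generating functions are finite and agree near `0`
are equal. -/
theorem MeasureTheory.Measure.ext_of_mgf_eventuallyEq {μ ν : Measure ℝ}
    [IsFiniteMeasure μ] [IsFiniteMeasure ν]
    (hμ : 0 ∈ interior (integrableExpSet id μ)) (hν : 0 ∈ interior (integrableExpSet id ν))
    (h : mgf id μ =ᶠ[𝓝 0] mgf id ν) : μ = ν := by
  set S := interior (integrableExpSet id μ) ∩ interior (integrableExpSet id ν)
  have hconv : Convex ℝ S := convex_integrableExpSet.interior.inter convex_integrableExpSet.interior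
  have key : EqOn (complexMGF id μ) (complexMGF id ν) {z | z.re ∈ S} := by
    have hX : AnalyticOnNhd ℂ (complexMGF id μ) {z | z.re ∈ S} :=
      analyticOnNhd_complexMGF.mono fun z hz => hz.1
    have hY : AnalyticOnNhd ℂ (complexMGF id ν) {z | z.re ∈ S} :=
      analyticOnNhd_complexMGF.mono fun z hz => hz.2
    refine AnalyticOnNhd.eqOn_of_preconnected_of_frequently_eq hX hY
      (hconv.linear_preimage Complex.reLm).isPreconnected (z₀ := 0)
      ⟨by simpa using hμ, by simpa using hν⟩ ?_
    have h_real : ∃ᶠ x : ℝ in 𝓝[≠] 0, complexMGF id μ x = complexMGF id ν x := by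
      refine Eventually.frequently ?_
      filter_upwards [h.filter_mono nhdsWithin_le_nhds] with y hy
      rw [complexMGF_ofReal, complexMGF_ofReal, hy]
    refine Tendsto.frequently (f := fun x : ℝ => (x : ℂ)) ?_ h_real
    refine tendsto_nhdsWithin_iff.2 ⟨?_, ?_⟩
    · exact (Complex.continuous_ofReal.tendsto' 0 0 (by simp)).mono_left nhdsWithin_le_nhds
    · filter_upwards [self_mem_nhdsWithin] with x hx
      simpa using hx
  refine Measure.ext_of_charFun (funext fun t => ?_)
  rw [← complexMGF_id_mul_I, ← complexMGF_id_mul_I]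
  exact key ⟨by simpa using hμ, by simpa using hν⟩

/-- The integral of an exponential against a measure with density. -/
theorem lintegral_exp_withDensity_exp {m : Measure ℝ} {f : ℝ → ℝ≥0∞} (hf : AEMeasurable f m)
    (u : ℝ) :
    ∫⁻ t, ENNReal.ofReal (Real.exp (u * t))
        ∂(m.withDensity fun t => ENNReal.ofReal (Real.exp (-t)) * f t) =
      ∫⁻ t, ENNReal.ofReal (Real.exp (-(1 - u) * t)) * f t ∂m := by
  rw [lintegral_withDensity_eq_lintegral_mul₀ (by fun_prop) (by fun_prop)]
  refine lintegral_congr fun t => ?_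
  simp only [Pi.mul_apply]
  rw [mul_right_comm, ← ENNReal.ofReal_mul (Real.exp_pos _).le, ← Real.exp_add]
  ring_nf

open ProbabilityTheory in
/-- Uniqueness of the Laplace transform for nonnegative functions. -/
theorem ae_eq_of_lintegral_exp_mul_eq {m : Measure ℝ} [SigmaFinite m] {f g : ℝ → ℝ≥0∞}
    (hf : AEMeasurable f m) (hg : AEMeasurable g m)
    (hfin : ∀ p : ℝ, 0 < p → ∫⁻ t, ENNReal.ofReal (Real.exp (-p * t)) * f t ∂m ≠ ∞)
    (h : ∀ p : ℝ, 0 < p → ∫⁻ t, ENNReal.ofReal (Real.exp (-p * t)) * f t ∂m =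
      ∫⁻ t, ENNReal.ofReal (Real.exp (-p * t)) * g t ∂m) :
    f =ᵐ[m] g := by
  have aux (φ : ℝ → ℝ≥0∞) (hφ : AEMeasurable φ m)
      (hφfin : ∀ p : ℝ, 0 < p → ∫⁻ t, ENNReal.ofReal (Real.exp (-p * t)) * φ t ∂m ≠ ∞) :
      IsFiniteMeasure (m.withDensity fun t => ENNReal.ofReal (Real.exp (-t)) * φ t) ∧
      0 ∈ interior (integrableExpSet id
        (m.withDensity fun t => ENNReal.ofReal (Real.exp (-t)) * φ t)) := by
    constructor
    · refine isFiniteMeasure_withDensity ?_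
      simpa using hφfin 1 one_pos
    · refine mem_interior.2 ⟨Iio 1, fun u hu => ?_, isOpen_Iio, by simp⟩
      refine ⟨by fun_prop, ?_⟩
      rw [hasFiniteIntegral_iff_ofReal (.of_forall fun _ => (Real.exp_pos _).le)]
      simp only [id]
      rw [lintegral_exp_withDensity_exp hφ]
      exact (hφfin _ (sub_pos.2 hu)).lt_top
  obtain ⟨_, hf0⟩ := aux f hf hfin
  obtain ⟨_, hg0⟩ := aux g hg fun p hp => h p hp ▸ hfin p hp
  have heq := Measure.ext_of_mgf_eventuallyEq hf0 hg0 <| by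
    filter_upwards [Iio_mem_nhds (zero_lt_one' ℝ)] with u hu
    simp only [mgf, id]
    rw [integral_eq_lintegral_of_nonneg_ae (.of_forall fun _ => (Real.exp_pos _).le) (by fun_prop),
      integral_eq_lintegral_of_nonneg_ae (.of_forall fun _ => (Real.exp_pos _).le) (by fun_prop),
      lintegral_exp_withDensity_exp hf, lintegral_exp_withDensity_exp hg, h _ (sub_pos.2 hu)]
  rw [withDensity_eq_iff_of_sigmaFinite (by fun_prop) (by fun_prop)] at heq
  filter_upwards [heq] with t ht
  exact (ENNReal.mul_right_inj (by simp [Real.exp_pos]) ENNReal.ofReal_ne_top).1 ht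

/-- The Laplace transform of an exponential. -/
theorem lintegral_exp_neg_mul_Ioi {a : ℝ} (ha : 0 < a) :
    ∫⁻ s in Ioi 0, ENNReal.ofReal (Real.exp (-a * s)) = ENNReal.ofReal a⁻¹ := by
  rw [← ofReal_integral_eq_lintegral_ofReal (integrableOn_exp_mul_Ioi (neg_neg_of_pos ha) 0)
    (.of_forall fun _ => (Real.exp_pos _).le), integral_exp_mul_Ioi (neg_neg_of_pos ha)]
  simp [neg_div_neg_eq]

/-- The iterated Laplace transform of a measure is its Stieltjes transform. -/
theorem lintegral_exp_mul_lintegral_exp {ν : Measure ℝ} [SFinite ν] (hν : ∀ᵐ t ∂ν, 0 ≤ t)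
    {p : ℝ} (hp : 0 < p) :
    ∫⁻ s in Ioi 0, ENNReal.ofReal (Real.exp (-p * s)) *
        ∫⁻ t, ENNReal.ofReal (Real.exp (-t * s)) ∂ν =
      ∫⁻ t, ENNReal.ofReal (p + t)⁻¹ ∂ν := by
  calc
    _ = ∫⁻ s in Ioi 0, ∫⁻ t, ENNReal.ofReal (Real.exp (-(p + t) * s)) ∂ν := by
      refine lintegral_congr fun s => ?_
      rw [← lintegral_const_mul _ (by fun_prop)]
      refine lintegral_congr fun t => ?_
      rw [← ENNReal.ofReal_mul (Real.exp_pos _).le, ← Real.exp_add]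
      ring_nf
    _ = ∫⁻ t, (∫⁻ s in Ioi 0, ENNReal.ofReal (Real.exp (-(p + t) * s))) ∂ν :=
      lintegral_lintegral_swap (by fun_prop)
    _ = _ := by
      refine lintegral_congr_ae ?_
      filter_upwards [hν] with t ht
      exact lintegral_exp_neg_mul_Ioi (by linarith)

/-- Integrability of `(1 + t)⁻¹` implies integrability of `(p + t)⁻¹`. -/
theorem integrable_inv_add {ν : Measure ℝ} (hν : ∀ᵐ t ∂ν, 0 ≤ t)
    (h : Integrable (fun t => (1 + t)⁻¹) ν) {p : ℝ} (hp : 0 < p) :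
    Integrable (fun t => (p + t)⁻¹) ν := by
  refine (h.const_mul (1 + p⁻¹)).mono' (by fun_prop) ?_
  filter_upwards [hν] with t ht
  have h1 : 0 < p + t := by linarith
  have h2 : 0 < 1 + t := by linarith
  rw [Real.norm_of_nonneg (by positivity)]
  field_simp
  nlinarith

/-- Integrability of `(1 + t)⁻¹` implies integrability of `exp (-t * s)` for `s > 0`. -/
theorem integrable_exp_neg_mul_of_integrable_inv {ν : Measure ℝ} (hν : ∀ᵐ t ∂ν, 0 ≤ t)
    (h : Integrable (fun t => (1 + t)⁻¹) ν) {s : ℝ} (hs : 0 < s) :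
    Integrable (fun t => Real.exp (-t * s)) ν := by
  refine ((integrable_inv_add hν h (inv_pos.2 hs)).const_mul s⁻¹).mono' (by fun_prop) ?_
  filter_upwards [hν] with t ht
  rw [Real.norm_of_nonneg (Real.exp_pos _).le, ← mul_inv, mul_add, mul_inv_cancel₀ hs.ne',
    neg_mul, Real.exp_neg]
  refine inv_anti₀ (by positivity) ?_
  linarith [Real.add_one_le_exp (t * s), mul_comm s t]

/-- A measure on `[0, ∞)` integrating `(1 + t)⁻¹` is σ-finite. -/
theorem sigmaFinite_of_integrable_inv {ν : Measure ℝ} (hν : ∀ᵐ t ∂ν, 0 ≤ t)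
    (h : Integrable (fun t => (1 + t)⁻¹) ν) : SigmaFinite ν := by
  have := isFiniteMeasure_withDensity_ofReal h.2
  have hpos : ∀ᵐ t ∂ν, ENNReal.ofReal (1 + t)⁻¹ ≠ 0 := by
    filter_upwards [hν] with t ht
    simp only [ne_eq, ENNReal.ofReal_eq_zero, not_le]
    positivity
  rw [← withDensity_inv_same₀ (μ := ν) (f := fun t => ENNReal.ofReal (1 + t)⁻¹) (by fun_prop) hpos
    (.of_forall fun _ => ENNReal.ofReal_ne_top)]
  refine SigmaFinite.withDensity_of_ne_top ?_
  refine (withDensity_absolutelyContinuous _ _).ae_le ?_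
  filter_upwards [hpos] with t ht
  simpa using ht

open ProbabilityTheory in
/-- The Laplace transform of a measure on `[0, ∞)` is completely monotone. -/
theorem completelyMonotone_integral_exp {ν : Measure ℝ} (hν : ∀ᵐ t ∂ν, 0 ≤ t)
    (h : ∀ s : ℝ, 0 < s → Integrable (fun t => Real.exp (-t * s)) ν) :
    CompletelyMonotone fun s => ∫ t, Real.exp (-t * s) ∂ν := by
  have hmgf : (fun s => ∫ t, Real.exp (-t * s) ∂ν) = fun s => mgf id ν (-s) := by
    ext s
    simp [mgf, mul_comm]
  have hint {s : ℝ} (hs : 0 < s) : -s ∈ interior (integrableExpSet id ν) := by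
    refine mem_interior.2 ⟨Iio 0, fun u hu => ?_, isOpen_Iio, by simpa using hs⟩
    simpa [integrableExpSet, mul_comm] using h (-u) (neg_pos.2 hu)
  rw [hmgf]
  refine ⟨fun s hs => ?_, fun n s hs => ?_⟩
  · have : AnalyticAt ℝ (fun s => mgf id ν (-s)) s :=
      (analyticAt_mgf (hint hs)).comp_of_eq (analyticAt_id.neg) rfl
    exact this.contDiffAt.contDiffWithinAt
  · rw [iteratedDeriv_comp_neg, iteratedDeriv_mgf (hint hs), smul_eq_mul, ← mul_assoc,
      ← mul_pow]
    simp only [mul_neg, mul_one, neg_neg, one_pow, one_mul, id]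
    refine integral_nonneg_of_ae ?_
    filter_upwards [hν] with t ht
    positivity

/-- The Laplace transform of a measure on `(0, ∞)` vanishes at infinity. -/
theorem tendsto_integral_exp_atTop {ν : Measure ℝ} (hν : ∀ᵐ t ∂ν, 0 < t)
    (h : Integrable (fun t => Real.exp (-t * 1)) ν) :
    Tendsto (fun s => ∫ t, Real.exp (-t * s) ∂ν) atTop (𝓝 0) := by
  have := tendsto_integral_filter_of_dominated_convergence (μ := ν) (l := atTop)
    (F := fun s t => Real.exp (-t * s)) (f := fun _ => 0) (fun t => Real.exp (-t * 1))
    (.of_forall fun s => by fun_prop) ?_ h ?_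
  · simpa using this
  · filter_upwards [eventually_ge_atTop 1] with s hs
    filter_upwards [hν] with t ht
    rw [Real.norm_of_nonneg (Real.exp_pos _).le, Real.exp_le_exp]
    nlinarith
  · filter_upwards [hν] with t ht
    exact Real.tendsto_exp_atBot.comp (tendsto_id.const_mul_atTop_of_neg (neg_neg_of_pos ht))

/-- A measure has no atom at `0` if `p` times its Stieltjes transform vanishes at `0`. -/
theorem measure_singleton_zero_of_tendsto {ν : Measure ℝ} (hν : ∀ᵐ t ∂ν, 0 ≤ t)
    (h : Integrable (fun t => (1 + t)⁻¹) ν)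
    (hlim : Tendsto (fun p => p * ∫ t, (p + t)⁻¹ ∂ν) (𝓝[>] 0) (𝓝 0)) : ν {0} = 0 := by
  have hle : ∀ p : ℝ, 0 < p → ν {0} ≤ ENNReal.ofReal (p * ∫ t, (p + t)⁻¹ ∂ν) := by
    intro p hp
    have hnn : ∀ᵐ t ∂ν, 0 ≤ p * (p + t)⁻¹ := by
      filter_upwards [hν] with t ht
      positivity
    rw [← integral_const_mul, ofReal_integral_eq_lintegral_ofReal
      ((integrable_inv_add hν h hp).const_mul p) hnn]
    calc ν {0} = ∫⁻ t in {0}, ENNReal.ofReal (p * (p + t)⁻¹) ∂ν := by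
          simp [hp.ne']
      _ ≤ _ := setLIntegral_le_lintegral _ _
  have hlim' := (ENNReal.continuous_ofReal.tendsto 0).comp hlim
  rw [ENNReal.ofReal_zero] at hlim'
  refine le_antisymm (ge_of_tendsto hlim' ?_) zero_le
  filter_upwards [self_mem_nhdsWithin] with p hp
  exact hle p hp

/-- Under assumption (*), with `K(p) = ∫ (p+t)⁻¹ σ(dt)`, the
measure `σ` has no atom at `0`, and `k(s) = ∫_{(0,∞)} e^{-ts} σ(dt)` for almost
every `s > 0`; in particular `k` agrees a.e. with a completely monotone function,
and this completely monotone version tends to `0` as `s → ∞`. -/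
theorem statement4
    (k K : ℝ → ℝ) (σ : MeasureTheory.Measure ℝ)
    (hk_nonneg : ∀ t, 0 < t → 0 ≤ k t)
    (hk_loc : ∀ T, 0 < T → MeasureTheory.IntegrableOn k (Set.Ioc 0 T))
    (hK_int : ∀ p, 0 < p →
      MeasureTheory.IntegrableOn (fun t => Real.exp (-p * t) * k t) (Set.Ioi 0))
    (hK_def : ∀ p, 0 < p → K p = ∫ t in Set.Ioi 0, Real.exp (-p * t) * k t)
    (hσ_int : MeasureTheory.IntegrableOn (fun t => (1 + t)⁻¹) (Set.Ici 0) σ)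
    (hK_st : ∀ p, 0 < p → K p = ∫ t in Set.Ici 0, (p + t)⁻¹ ∂σ)
    (hK_zero : Filter.Tendsto K (nhdsWithin 0 (Set.Ioi 0)) Filter.atTop)
    (hK_inf : Filter.Tendsto K Filter.atTop (nhds 0))
    (hpK_zero : Filter.Tendsto (fun p => p * K p) (nhdsWithin 0 (Set.Ioi 0)) (nhds 0))
    (hpK_inf : Filter.Tendsto (fun p => p * K p) Filter.atTop Filter.atTop) :
    σ {0} = 0 ∧
    (∀ᵐ s ∂(volume.restrict (Set.Ioi 0)),
      k s = ∫ t in Set.Ioi 0, Real.exp (-t * s) ∂σ) ∧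
    CompletelyMonotone (fun s => ∫ t in Set.Ioi 0, Real.exp (-t * s) ∂σ) ∧
    Filter.Tendsto (fun s => ∫ t in Set.Ioi 0, Real.exp (-t * s) ∂σ)
      Filter.atTop (nhds 0) := by
  have hν : ∀ᵐ t ∂(σ.restrict (Ici 0)), 0 ≤ t := ae_restrict_mem measurableSet_Ici
  have hsf := sigmaFinite_of_integrable_inv hν hσ_int
  have hatom : σ {0} = 0 := by
    rw [← Measure.restrict_eq_self σ (singleton_subset_iff.2 self_mem_Ici)]
    refine measure_singleton_zero_of_tendsto hν hσ_int (hpK_zero.congr' ?_)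
    filter_upwards [self_mem_nhdsWithin] with p hp
    rw [hK_st p hp]
  have hrestr : σ.restrict (Ioi 0) = σ.restrict (Ici 0) :=
    Measure.restrict_congr_set (Ioi_ae_eq_Ici' hatom)
  have hν' : ∀ᵐ t ∂(σ.restrict (Ici 0)), 0 < t := hrestr ▸ ae_restrict_mem measurableSet_Ioi
  rw [hrestr]
  have hexp (s : ℝ) (hs : 0 < s) := integrable_exp_neg_mul_of_integrable_inv hν hσ_int hs
  refine ⟨hatom, ?_, completelyMonotone_integral_exp hν hexp,
    tendsto_integral_exp_atTop hν' (hexp 1 one_pos)⟩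
  have hk_meas : AEMeasurable k (volume.restrict (Ioi 0)) := by
    have h1 : AEMeasurable (fun t => Real.exp t * (Real.exp (-1 * t) * k t))
      (volume.restrict (Ioi 0)) := by
      have := (hK_int 1 one_pos).aemeasurable
      fun_prop
    refine h1.congr (.of_forall fun t => ?_)
    simp [← mul_assoc, ← Real.exp_add]
  have hk_lap (p : ℝ) (hp : 0 < p) :
      ∫⁻ t in Ioi 0, ENNReal.ofReal (Real.exp (-p * t)) * ENNReal.ofReal (k t) =
        ENNReal.ofReal (K p) := by
    rw [hK_def p hp, ofReal_integral_eq_lintegral_ofReal (hK_int p hp)]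
    · exact lintegral_congr fun t => (ENNReal.ofReal_mul (Real.exp_pos _).le).symm
    · filter_upwards [ae_restrict_mem measurableSet_Ioi] with t ht
      exact mul_nonneg (Real.exp_pos _).le (hk_nonneg t ht)
  have hae := ae_eq_of_lintegral_exp_mul_eq (m := volume.restrict (Ioi 0))
    (f := fun t => ENNReal.ofReal (k t))
    (g := fun s => ∫⁻ t in Ici 0, ENNReal.ofReal (Real.exp (-t * s)) ∂σ) (by fun_prop)
    (Measurable.lintegral_prod_right'
      (f := fun z : ℝ × ℝ => ENNReal.ofReal (Real.exp (-z.2 * z.1))) (by fun_prop)).aemeasurable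
    (fun p hp => by rw [hk_lap p hp]; exact ENNReal.ofReal_ne_top)
    (fun p hp => by
      rw [hk_lap p hp, lintegral_exp_mul_lintegral_exp hν hp, hK_st p hp]
      refine ofReal_integral_eq_lintegral_ofReal (integrable_inv_add hν hσ_int hp) ?_
      filter_upwards [hν] with t ht
      positivity)
  filter_upwards [hae, ae_restrict_mem measurableSet_Ioi] with s hs hs0
  rw [← ENNReal.toReal_ofReal (hk_nonneg s hs0), hs,
    integral_eq_lintegral_of_nonneg_ae (.of_forall fun _ => (Real.exp_pos _).le) (by fun_prop)]
end

section
/- Suppose k satisfies assumption (*) and let λ > 0. Then there exists a completely monotone function g : (0,∞) → [0,1] such that ∫₀^∞ e^{−ps} g(s) ds = K(p)/(p·K(p) + λ) for all p > 0, and g(t) → 1 as t → 0+. -/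
open MeasureTheory Filter Set

/-- The resolvent `⟨v, (p + S)⁻¹ v⟩` of a positive semidefinite matrix is a finite Stieltjes sum. -/
theorem exists_spectral_weights {ι : Type*} [Fintype ι] [DecidableEq ι] {S : Matrix ι ι ℝ}
    (hS : S.PosSemidef) (v : ι → ℝ) :
    ∃ m s : ι → ℝ, (∀ j, 0 ≤ m j) ∧ (∀ j, 0 ≤ s j) ∧ ∑ j, m j = v ⬝ᵥ v ∧
      ∀ (p : ℝ) (w : ι → ℝ), 0 < p → p • w + S.mulVec w = v →
        v ⬝ᵥ w = ∑ j, m j / (p + s j) := by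
  let e : ι → ι → ℝ := fun j => WithLp.ofLp (hS.1.eigenvectorBasis j)
  have parseval : ∀ x y : ι → ℝ, x ⬝ᵥ y = ∑ j, (e j ⬝ᵥ x) * (e j ⬝ᵥ y) := by
    intro x y
    have := hS.1.eigenvectorBasis.sum_inner_mul_inner (WithLp.toLp 2 y) (WithLp.toLp 2 x)
    simp only [EuclideanSpace.inner_eq_star_dotProduct, star_trivial] at this
    rw [← this]
    refine Finset.sum_congr rfl fun j _ => ?_
    rw [dotProduct_comm x, mul_comm]
  have eigen : ∀ j x, e j ⬝ᵥ S.mulVec x = hS.1.eigenvalues j * (e j ⬝ᵥ x) := by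
    intro j x
    have h0 : S.IsSymm := by simpa using hS.1
    have h1 : S.transpose = S := h0
    have h2 := hS.1.mulVec_eigenvectorBasis j
    rw [Matrix.dotProduct_mulVec, ← Matrix.mulVec_transpose, h1]
    change S.mulVec (hS.1.eigenvectorBasis j) ⬝ᵥ x = _
    rw [h2, smul_dotProduct]
    rfl
  refine ⟨fun j => (e j ⬝ᵥ v) ^ 2, hS.1.eigenvalues, fun j => sq_nonneg _,
    hS.eigenvalues_nonneg, ?_, fun p w hp hw => ?_⟩
  · rw [parseval v v]; simp only [sq]
  · rw [parseval v w]
    refine Finset.sum_congr rfl fun j _ => ?_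
    have hpos : 0 < p + hS.1.eigenvalues j := add_pos_of_pos_of_nonneg hp (hS.eigenvalues_nonneg j)
    have : e j ⬝ᵥ v = (p + hS.1.eigenvalues j) * (e j ⬝ᵥ w) := by
      conv_lhs => rw [← hw]
      rw [dotProduct_add, dotProduct_smul, eigen, smul_eq_mul]; ring
    simp only [this]; field_simp

/-- If `K` is a finite Stieltjes sum, so is `K / (p K + λ)`, with total weight at most one. It is the
resolvent of a rank-one congruence of the diagonal matrix of poles of `K`. -/
theorem exists_weights_resolvent_sum {ι : Type*} [Fintype ι] {c t : ι → ℝ} (hc : ∀ i, 0 ≤ c i)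
    (ht : ∀ i, 0 ≤ t i) {lam : ℝ} (hlam : 0 < lam) :
    ∃ m s : ι → ℝ, (∀ j, 0 ≤ m j) ∧ (∀ j, 0 ≤ s j) ∧ ∑ j, m j ≤ 1 ∧
      ∀ p : ℝ, 0 < p → (∑ i, c i / (p + t i)) / (p * (∑ i, c i / (p + t i)) + lam) =
        ∑ j, m j / (p + s j) := by
  classical
  let v : ι → ℝ := fun i => √(c i)
  have hv : ∀ i, v i * v i = c i := fun i => Real.mul_self_sqrt (hc i)
  set C := ∑ i, c i with hC
  have hC0 : 0 ≤ C := Finset.sum_nonneg fun i _ => hc i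
  have hvv : v ⬝ᵥ v = C := by simp only [dotProduct, hv, hC]
  have hlC : 0 < lam + C := by positivity
  set α := (lam + C)⁻¹ with hα
  have hα0 : 0 < α := by positivity
  set γ := √(lam * α) with hγ
  have hγ0 : 0 < γ := by positivity
  have hγ2 : γ * γ = lam * α := Real.mul_self_sqrt (by positivity)
  have hαl : α * (lam + C) = 1 := inv_mul_cancel₀ hlC.ne'
  set β := α / (1 + γ) with hβ
  have hβα : β * (1 + γ) = α := by rw [hβ]; field_simp
  have hβC : 1 - β * C = γ := by
    rw [hβ]; field_simp; linarith
  let Q : Matrix ι ι ℝ := 1 - β • Matrix.vecMulVec v v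
  have hQ : ∀ x i, Q.mulVec x i = x i - β * (v ⬝ᵥ x) * v i := by
    intro x i
    simp [Q, Matrix.sub_mulVec, Matrix.smul_mulVec, Matrix.vecMulVec_mulVec]; ring
  have hQt : Q.conjTranspose = Q := by
    simp [Q, Matrix.transpose_vecMulVec]
  have hS : (Q.conjTranspose * Matrix.diagonal t * Q).PosSemidef :=
    (Matrix.PosSemidef.diagonal ht).conjTranspose_mul_mul_same Q
  obtain ⟨m, s, hm, hs, hsum, hres⟩ := exists_spectral_weights hS v
  refine ⟨fun j => α * m j, s, fun j => mul_nonneg hα0.le (hm j), hs, ?_, fun p hp => ?_⟩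
  · rw [← Finset.mul_sum, hsum, hvv]; nlinarith
  set K := ∑ i, c i / (p + t i) with hK
  have hpt : ∀ i, 0 < p + t i := fun i => add_pos_of_pos_of_nonneg hp (ht i)
  have hK0 : 0 ≤ K := Finset.sum_nonneg fun i _ => div_nonneg (hc i) (hpt i).le
  have hden : 0 < p * K + lam := by positivity
  set r := (lam + C) * (K / (p * K + lam)) with hr
  have hr' : α * r = K / (p * K + lam) := by rw [hr, ← mul_assoc, hαl, one_mul]
  let x : ι → ℝ := fun i => (v i + α * r * t i * v i) / (p + t i)
  have hvx : v ⬝ᵥ x = r := by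
    have : ∀ i, v i * x i = (1 - p * (α * r)) * (c i / (p + t i)) + α * r * c i := by
      intro i
      have := (hpt i).ne'
      simp only [x, ← hv]; field_simp; ring
    simp only [dotProduct, this, Finset.sum_add_distrib, ← Finset.mul_sum]
    rw [← hC, ← hK, hr', hr]
    field_simp; ring
  let z : ι → ℝ := fun i => x i - β * r * v i
  have hz : Q.mulVec x = z := by ext i; rw [hQ, hvx]
  have hvz : v ⬝ᵥ z = γ * r := by
    have : z = x - (β * r) • v := by ext i; simp [z]
    rw [this, dotProduct_sub, dotProduct_smul, hvx, hvv, ← hβC, smul_eq_mul]; ring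
  have hD : (Matrix.diagonal t).mulVec (Q.mulVec z) = v - p • x := by
    ext i
    have h1 := (hpt i).ne'
    have h2 : (p + t i) * x i = v i + α * r * t i * v i := by simp only [x]; field_simp
    rw [Matrix.mulVec_diagonal, hQ, hvz]
    simp only [z, Pi.sub_apply, Pi.smul_apply, smul_eq_mul]
    linear_combination h2 - t i * r * v i * hβα
  have hSz : p • z + (Q.conjTranspose * Matrix.diagonal t * Q).mulVec z = γ • v := by
    rw [hQt, ← Matrix.mulVec_mulVec, ← Matrix.mulVec_mulVec, hD]
    ext i
    simp only [Pi.add_apply, Pi.smul_apply, smul_eq_mul, hQ, z, dotProduct_sub, dotProduct_smul,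
      hvx, hvv, Pi.sub_apply, ← hβC]
    ring
  have := hres p (γ⁻¹ • z) hp (by
    rw [smul_comm, Matrix.mulVec_smul, ← smul_add, hSz, smul_smul, inv_mul_cancel₀ hγ0.ne',
      one_smul])
  rw [dotProduct_smul, hvz, smul_eq_mul, inv_mul_cancel_left₀ hγ0.ne'] at this
  rw [← hr', this, Finset.mul_sum]
  simp only [mul_div_assoc]

/-- The Cauchy kernel `1 / (p + t)` in the compactified variable `u = 1 / (1 + t)`. -/
noncomputable def compactCauchyKernel (p : ℝ) (u : unitInterval) : ℝ :=
  (u : ℝ) / (1 - u + p * u)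

theorem compactCauchyKernel_denom_pos {p : ℝ} (hp : 0 < p) (u : unitInterval) :
    0 < 1 - (u : ℝ) + p * u := by
  rcases u.2.1.eq_or_lt with h | h
  · rw [← h]; norm_num
  · have := mul_pos hp h
    linarith [u.2.2]

theorem continuous_compactCauchyKernel {p : ℝ} (hp : 0 < p) :
    Continuous (compactCauchyKernel p) := by
  unfold compactCauchyKernel
  exact Continuous.div (by fun_prop) (by fun_prop) fun u => (compactCauchyKernel_denom_pos hp u).ne'

theorem exists_probabilityMeasure_resolvent_sum {ι : Type*} [Fintype ι] {c t : ι → ℝ}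
    (hc : ∀ i, 0 ≤ c i) (ht : ∀ i, 0 ≤ t i) {lam : ℝ} (hlam : 0 < lam) :
    ∃ P : ProbabilityMeasure unitInterval, ∀ p : ℝ, 0 < p →
      (∑ i, c i / (p + t i)) / (p * (∑ i, c i / (p + t i)) + lam) =
        ∫ u, compactCauchyKernel p u ∂(P : Measure unitInterval) := by
  obtain ⟨m, s, hm, hs, hsum, hres⟩ := exists_weights_resolvent_sum hc ht hlam
  let u : ι → unitInterval := fun j => ⟨(1 + s j)⁻¹, by
    have := hs j
    exact ⟨by positivity, inv_le_one_of_one_le₀ (by linarith)⟩⟩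
  let P : Measure unitInterval := (∑ j, ENNReal.ofReal (m j) • Measure.dirac (u j)) +
    ENNReal.ofReal (1 - ∑ j, m j) • Measure.dirac 0
  have hP : IsProbabilityMeasure P := by
    constructor
    simp only [P, Measure.coe_add, Measure.coe_finsetSum, Pi.add_apply, Finset.sum_apply,
      Measure.smul_apply, measure_univ, smul_eq_mul, mul_one]
    rw [← ENNReal.ofReal_sum_of_nonneg fun j _ => hm j,
      ← ENNReal.ofReal_add (Finset.sum_nonneg fun j _ => hm j) (by linarith)]
    simp
  refine ⟨⟨P, hP⟩, fun p hp => ?_⟩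
  rw [hres p hp]
  have hint : ∀ (a : ℝ) (x : unitInterval), Integrable (compactCauchyKernel p)
      (ENNReal.ofReal a • Measure.dirac x) := fun a x =>
    (integrable_dirac (by simp)).smul_measure ENNReal.ofReal_ne_top
  change _ = ∫ u, compactCauchyKernel p u ∂P
  rw [integral_add_measure (integrable_finsetSum_measure.2 fun j _ => hint _ _) (hint _ _),
    integral_finsetSum_measure fun j _ => hint _ _]
  simp only [integral_smul_measure, integral_dirac, ENNReal.toReal_ofReal (hm _), smul_eq_mul]
  have h0 : compactCauchyKernel p 0 = 0 := by simp [compactCauchyKernel]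
  rw [h0, mul_zero, add_zero]
  refine Finset.sum_congr rfl fun j _ => ?_
  have h1 : 0 < 1 + s j := by linarith [hs j]
  have h2 : 0 < p + s j := by linarith [hs j]
  have h3 : 1 - (1 + s j)⁻¹ + p * (1 + s j)⁻¹ = (p + s j) / (1 + s j) := by field_simp; ring
  simp only [compactCauchyKernel, u, h3]
  field_simp

theorem exists_probabilityMeasure_of_simpleFunc (ν : Measure ℝ) [IsFiniteMeasure ν]
    (φ : SimpleFunc ℝ ℝ) (hφ : ∀ x, 0 ≤ φ x) {lam : ℝ} (hlam : 0 < lam) :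
    ∃ P : ProbabilityMeasure unitInterval, ∀ p : ℝ, 0 < p →
      (∫ x, (1 + φ x) / (p + φ x) ∂ν) / (p * (∫ x, (1 + φ x) / (p + φ x) ∂ν) + lam) =
        ∫ u, compactCauchyKernel p u ∂(P : Measure unitInterval) := by
  have hrange : ∀ y : φ.range, 0 ≤ (y : ℝ) := by
    rintro ⟨y, hy⟩
    obtain ⟨x, rfl⟩ := SimpleFunc.mem_range.1 hy
    exact hφ x
  obtain ⟨P, hP⟩ := exists_probabilityMeasure_resolvent_sum (ι := φ.range)
    (c := fun y => ν.real (φ ⁻¹' {(y : ℝ)}) * (1 + y)) (t := fun y => y)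
    (fun y => mul_nonneg measureReal_nonneg (by linarith [hrange y])) hrange hlam
  refine ⟨P, fun p hp => ?_⟩
  rw [← hP p hp]
  have : ∫ x, (1 + φ x) / (p + φ x) ∂ν =
      ∑ y : φ.range, ν.real (φ ⁻¹' {(y : ℝ)}) * (1 + y) / (p + y) := by
    have hpt : ∀ x, (1 + φ x) / (p + φ x) =
        ∑ y : φ.range, (φ ⁻¹' {(y : ℝ)}).indicator (fun _ => (1 + (y : ℝ)) / (p + y)) x := by
      intro x
      rw [Finset.sum_eq_single ⟨φ x, φ.mem_range_self x⟩]
      · simp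
      · intro y _ hy
        refine indicator_of_notMem (fun hx => hy (Subtype.ext ?_)) _
        exact (mem_singleton_iff.1 hx).symm
      · simp
    simp only [hpt]
    rw [integral_finsetSum _ fun y _ =>
      (integrable_const _).indicator (φ.measurableSet_preimage _)]
    refine Finset.sum_congr rfl fun y _ => ?_
    rw [integral_indicator_const _ (φ.measurableSet_preimage _), smul_eq_mul, mul_div_assoc]
  rw [this]

/-- If `K` is a Stieltjes function, then `K / (p K + λ)` is the Cauchy transform of a probability
measure on the compactified half-line. -/
theorem exists_probabilityMeasure_stieltjes (ν : Measure ℝ) [IsFiniteMeasure ν]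
    (hν : ∀ᵐ x ∂ν, 0 ≤ x) {lam : ℝ} (hlam : 0 < lam) :
    ∃ P : ProbabilityMeasure unitInterval, ∀ p : ℝ, 0 < p →
      (∫ x, (1 + x) / (p + x) ∂ν) / (p * (∫ x, (1 + x) / (p + x) ∂ν) + lam) =
        ∫ u, compactCauchyKernel p u ∂(P : Measure unitInterval) := by
  let φ : ℕ → SimpleFunc ℝ ℝ :=
    SimpleFunc.approxOn (fun x : ℝ => x) measurable_id (Ici 0) 0 (mem_Ici.2 le_rfl)
  have hφ0 : ∀ n x, 0 ≤ φ n x := fun n x => SimpleFunc.approxOn_mem _ _ n x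
  have hφt : ∀ x, 0 ≤ x → Tendsto (fun n => φ n x) atTop (nhds x) := fun x hx =>
    SimpleFunc.tendsto_approxOn _ _ (subset_closure hx)
  choose P hP using fun n => exists_probabilityMeasure_of_simpleFunc ν (φ n) (hφ0 n) hlam
  let U : Ultrafilter (ProbabilityMeasure unitInterval) := (hyperfilter ℕ).map P
  obtain ⟨P₀, -, hP₀⟩ := isCompact_univ.ultrafilter_le_nhds U (by simp)
  refine ⟨P₀, fun p hp => ?_⟩
  have hlim : Tendsto P (hyperfilter ℕ : Filter ℕ) (nhds P₀) := hP₀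
  let f : BoundedContinuousFunction unitInterval ℝ :=
    BoundedContinuousFunction.mkOfCompact ⟨_, continuous_compactCauchyKernel hp⟩
  have h1 := ProbabilityMeasure.tendsto_iff_forall_integral_tendsto.1 hlim f
  have hK : Tendsto (fun n => ∫ x, (1 + φ n x) / (p + φ n x) ∂ν) atTop
      (nhds (∫ x, (1 + x) / (p + x) ∂ν)) := by
    refine tendsto_integral_of_dominated_convergence (fun _ => 1 + p⁻¹) ?_ (integrable_const _)
      ?_ ?_
    · intro n
      exact (((φ n).measurable.const_add 1).div
        ((φ n).measurable.const_add p)).aestronglyMeasurable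
    · intro n
      refine ae_of_all _ fun x => ?_
      have h := hφ0 n x
      rw [Real.norm_of_nonneg (by positivity), div_le_iff₀ (by positivity)]
      have : (1 + p⁻¹) * (p + φ n x) = 1 + φ n x + p + p⁻¹ * φ n x := by field_simp; ring
      rw [this]
      have : 0 ≤ p⁻¹ * φ n x := by positivity
      linarith
    · filter_upwards [hν] with x hx
      exact ((hφt x hx).const_add 1).div ((hφt x hx).const_add p) (by positivity)
  have hpos : 0 ≤ ∫ x, (1 + x) / (p + x) ∂ν := integral_nonneg_of_ae <| by
    filter_upwards [hν] with x hx
    simp only [Pi.zero_apply]; positivity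
  have h2 := hK.div ((hK.const_mul p).add_const lam) (by positivity)
  have h2 := h2.congr fun n => hP n p hp
  exact tendsto_nhds_unique (h2.mono_left Nat.hyperfilter_le_atTop) h1

section NonposMgf

open ProbabilityTheory

variable {Ω : Type*} [MeasurableSpace Ω] {P : Measure Ω} [IsProbabilityMeasure P] {X : Ω → ℝ}

theorem integrable_exp_mul_of_nonpos (hX : Measurable X) (hX0 : ∀ ω, X ω ≤ 0) {t : ℝ}
    (ht : 0 ≤ t) : Integrable (fun ω => Real.exp (t * X ω)) P :=
  (integrable_const (1 : ℝ)).mono' (by fun_prop) <| ae_of_all _ fun ω => by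
    rw [Real.norm_of_nonneg (Real.exp_pos _).le, Real.exp_le_one_iff]
    exact mul_nonpos_of_nonneg_of_nonpos ht (hX0 ω)

theorem mem_interior_integrableExpSet_of_nonpos (hX : Measurable X) (hX0 : ∀ ω, X ω ≤ 0) {t : ℝ}
    (ht : 0 < t) : t ∈ interior (integrableExpSet X P) :=
  interior_mono (fun _ hs => integrable_exp_mul_of_nonpos hX hX0 (mem_Ici.1 hs))
    (by rwa [interior_Ici] : t ∈ interior (Ici (0 : ℝ)))

theorem completelyMonotone_mgf (hX : Measurable X) (hX0 : ∀ ω, X ω ≤ 0) :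
    CompletelyMonotone (mgf X P) := by
  refine ⟨fun t ht => (analyticAt_mgf
    (mem_interior_integrableExpSet_of_nonpos hX hX0 ht)).contDiffAt.contDiffWithinAt,
    fun n t ht => ?_⟩
  rw [iteratedDeriv_mgf (mem_interior_integrableExpSet_of_nonpos hX hX0 ht),
    ← integral_const_mul]
  refine integral_nonneg fun ω => ?_
  rw [Pi.zero_apply, ← mul_assoc, ← mul_pow, neg_one_mul]
  exact mul_nonneg (pow_nonneg (neg_nonneg.2 (hX0 ω)) n) (Real.exp_pos _).le

theorem mgf_mem_Icc_of_nonpos (hX : Measurable X) (hX0 : ∀ ω, X ω ≤ 0) {t : ℝ} (ht : 0 < t) :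
    mgf X P t ∈ Icc (0 : ℝ) 1 := by
  refine ⟨mgf_nonneg, ?_⟩
  calc mgf X P t ≤ ∫ _, (1 : ℝ) ∂P :=
        integral_mono (integrable_exp_mul_of_nonpos hX hX0 ht.le) (integrable_const _) fun ω =>
          Real.exp_le_one_iff.2 (mul_nonpos_of_nonneg_of_nonpos ht.le (hX0 ω))
    _ = 1 := by simp

theorem tendsto_mgf_nhdsGT_zero (hX : Measurable X) (hX0 : ∀ ω, X ω ≤ 0) :
    Tendsto (mgf X P) (nhdsWithin 0 (Ioi 0)) (nhds 1) := by
  have h : Tendsto (mgf X P) (nhdsWithin 0 (Ioi 0)) (nhds (∫ _, (1 : ℝ) ∂P)) := by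
    refine tendsto_integral_filter_of_dominated_convergence (fun _ => (1 : ℝ)) ?_ ?_
      (integrable_const _) ?_
    · exact Eventually.of_forall fun t => by fun_prop
    · filter_upwards [self_mem_nhdsWithin] with t ht
      refine ae_of_all _ fun ω => ?_
      rw [Real.norm_of_nonneg (Real.exp_pos _).le, Real.exp_le_one_iff]
      exact mul_nonpos_of_nonneg_of_nonpos (le_of_lt ht) (hX0 ω)
    · refine ae_of_all _ fun ω => ?_
      have : Continuous fun t : ℝ => Real.exp (t * X ω) := by fun_prop
      simpa using (this.tendsto 0).mono_left nhdsWithin_le_nhds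
  simpa using h

theorem integrable_exp_neg_mul_exp_mul (hX : Measurable X) (hX0 : ∀ ω, X ω ≤ 0) {p : ℝ}
    (hp : 0 < p) : Integrable (Function.uncurry fun (s : ℝ) (ω : Ω) =>
      Real.exp (-p * s) * Real.exp (s * X ω)) ((volume.restrict (Ioi 0)).prod P) := by
  have hexp : Integrable (fun s : ℝ => Real.exp (-p * s)) (volume.restrict (Ioi 0)) :=
    exp_neg_integrableOn_Ioi 0 hp
  refine (hexp.comp_fst P).mono' ?_ ?_
  · refine Measurable.aestronglyMeasurable ?_
    unfold Function.uncurry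
    fun_prop
  · have : ∀ᵐ z ∂(volume.restrict (Ioi (0 : ℝ))).prod P, 0 < z.1 :=
      Measure.quasiMeasurePreserving_fst.ae (ae_restrict_mem measurableSet_Ioi)
    filter_upwards [this] with z hz
    rw [Function.uncurry, Real.norm_of_nonneg (by positivity)]
    exact mul_le_of_le_one_right (Real.exp_pos _).le
      (Real.exp_le_one_iff.2 (mul_nonpos_of_nonneg_of_nonpos hz.le (hX0 _)))

theorem integrableOn_exp_neg_mul_mgf (hX : Measurable X) (hX0 : ∀ ω, X ω ≤ 0) {p : ℝ}
    (hp : 0 < p) : IntegrableOn (fun s => Real.exp (-p * s) * mgf X P s) (Ioi 0) := by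
  have := (integrable_exp_neg_mul_exp_mul (P := P) hX hX0 hp).integral_prod_left
  simp only [Function.uncurry, integral_const_mul] at this
  exact this

theorem integral_exp_neg_mul_mgf (hX : Measurable X) (hX0 : ∀ ω, X ω ≤ 0) {p : ℝ}
    (hp : 0 < p) :
    ∫ s in Ioi 0, Real.exp (-p * s) * mgf X P s = ∫ ω, (p - X ω)⁻¹ ∂P := by
  have h := integral_integral_swap (integrable_exp_neg_mul_exp_mul (P := P) hX hX0 hp)
  simp only [integral_const_mul] at h
  refine h.trans (integral_congr_ae (ae_of_all _ fun ω => ?_))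
  have hneg : X ω - p < 0 := by linarith [hX0 ω]
  have h2 := integral_exp_mul_Ioi hneg 0
  simp only [mul_zero, Real.exp_zero] at h2
  simp only [← Real.exp_add]
  rw [show (p - X ω)⁻¹ = -1 / (X ω - p) by rw [← neg_sub, inv_neg, neg_div, one_div], ← h2]
  congr with s
  ring_nf

end NonposMgf

theorem measure_zero_eq_zero_of_tendsto (P : Measure unitInterval) [IsProbabilityMeasure P]
    (h : Tendsto (fun p => p * ∫ u, compactCauchyKernel p u ∂P) atTop (nhds 1)) :
    P {0} = 0 := by
  have hlim : Tendsto (fun p => p * ∫ u, compactCauchyKernel p u ∂P) atTop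
      (nhds (∫ u, ({0}ᶜ : Set unitInterval).indicator (fun _ => (1 : ℝ)) u ∂P)) := by
    simp only [← integral_const_mul]
    refine tendsto_integral_filter_of_dominated_convergence (fun _ => (1 : ℝ)) ?_ ?_
      (integrable_const _) ?_
    · filter_upwards [eventually_gt_atTop 0] with p hp
      exact ((continuous_compactCauchyKernel hp).const_mul p).aestronglyMeasurable
    · filter_upwards [eventually_gt_atTop 0] with p hp
      refine ae_of_all _ fun u => ?_
      have hd := compactCauchyKernel_denom_pos hp u
      have hu0 := u.2.1
      rw [compactCauchyKernel, Real.norm_of_nonneg (by positivity), ← mul_div_assoc,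
        div_le_one hd]
      linarith [u.2.2]
    · refine ae_of_all _ fun u => ?_
      by_cases hu : u = 0
      · simp [hu, compactCauchyKernel]
      · have hu0 : 0 < (u : ℝ) := unitInterval.pos_iff_ne_zero.2 hu
        rw [indicator_of_mem (by simpa using hu)]
        have hinv : Tendsto (fun p : ℝ => (u : ℝ) / ((1 - u) * p⁻¹ + u)) atTop
            (nhds (u / ((1 - u) * 0 + u))) :=
          tendsto_const_nhds.div ((tendsto_inv_atTop_zero.const_mul _).add_const _)
            (by simpa using hu0.ne')
        rw [mul_zero, zero_add, div_self hu0.ne'] at hinv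
        refine hinv.congr' ?_
        filter_upwards [eventually_gt_atTop 0] with p hp
        have hd := compactCauchyKernel_denom_pos hp u
        have hd' : 0 < (1 - (u : ℝ)) * p⁻¹ + u := by
          have := mul_nonneg (sub_nonneg.2 u.2.2) (inv_pos.2 hp).le
          linarith
        rw [compactCauchyKernel, ← mul_div_assoc, div_eq_div_iff hd'.ne' hd.ne']
        field_simp
  have := tendsto_nhds_unique hlim h
  rw [integral_indicator_const _ (measurableSet_singleton _).compl, smul_eq_mul, mul_one] at this
  rw [← prob_compl_eq_one_iff (measurableSet_singleton _)]
  rwa [measureReal_def, ENNReal.toReal_eq_one_iff] at this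

/-- Transfer of a probability measure without mass at `0` from the compactified variable. -/
theorem integral_inv_sub_eq_integral_compactCauchyKernel {P : Measure unitInterval}
    (hP : P {0} = 0) (p : ℝ) :
    ∫ u : unitInterval, (p - min 0 (1 - (u : ℝ)⁻¹))⁻¹ ∂P = ∫ u, compactCauchyKernel p u ∂P := by
  have hae : ∀ᵐ u ∂P, u ≠ 0 := by simpa [ae_iff] using hP
  refine integral_congr_ae ?_
  filter_upwards [hae] with u hu
  have hu0 : 0 < (u : ℝ) := unitInterval.pos_iff_ne_zero.2 hu
  rw [min_eq_right (sub_nonpos.2 ((one_le_inv₀ hu0).2 u.2.2)), compactCauchyKernel,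
    ← inv_div]
  congr 1
  field_simp
  ring

/-- Under assumption (*) and for `λ > 0`, there is a completely
monotone function `g : (0,∞) → [0,1]` whose Laplace transform is
`K(p)/(pK(p) + λ)`, and `g(t) → 1` as `t → 0+`. -/
theorem statement6
    (k K : ℝ → ℝ) (σ : MeasureTheory.Measure ℝ)
    (hk_nonneg : ∀ t, 0 < t → 0 ≤ k t)
    (hk_loc : ∀ T, 0 < T → MeasureTheory.IntegrableOn k (Set.Ioc 0 T))
    (hK_int : ∀ p, 0 < p →
      MeasureTheory.IntegrableOn (fun t => Real.exp (-p * t) * k t) (Set.Ioi 0))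
    (hK_def : ∀ p, 0 < p → K p = ∫ t in Set.Ioi 0, Real.exp (-p * t) * k t)
    (hσ_int : MeasureTheory.IntegrableOn (fun t => (1 + t)⁻¹) (Set.Ici 0) σ)
    (hK_st : ∀ p, 0 < p → K p = ∫ t in Set.Ici 0, (p + t)⁻¹ ∂σ)
    (hK_zero : Filter.Tendsto K (nhdsWithin 0 (Set.Ioi 0)) Filter.atTop)
    (hK_inf : Filter.Tendsto K Filter.atTop (nhds 0))
    (hpK_zero : Filter.Tendsto (fun p => p * K p) (nhdsWithin 0 (Set.Ioi 0)) (nhds 0))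
    (hpK_inf : Filter.Tendsto (fun p => p * K p) Filter.atTop Filter.atTop)
    (lam : ℝ) (hlam : 0 < lam) :
    ∃ g : ℝ → ℝ,
      CompletelyMonotone g ∧
      (∀ t, 0 < t → g t ∈ Set.Icc (0 : ℝ) 1) ∧
      (∀ p, 0 < p →
        IntegrableOn (fun s => Real.exp (-p * s) * g s) (Set.Ioi 0)) ∧
      (∀ p, 0 < p →
        ∫ s in Set.Ioi 0, Real.exp (-p * s) * g s = K p / (p * K p + lam)) ∧
      Filter.Tendsto g (nhdsWithin 0 (Set.Ioi 0)) (nhds 1) := by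
  have hmeas : Measurable fun t : ℝ => ENNReal.ofReal (1 + t)⁻¹ := by fun_prop
  let ν := (σ.restrict (Ici 0)).withDensity fun t => ENNReal.ofReal (1 + t)⁻¹
  have hνfin : IsFiniteMeasure ν := isFiniteMeasure_withDensity_ofReal hσ_int.2
  have hν0 : ∀ᵐ x ∂ν, 0 ≤ x :=
    (withDensity_absolutelyContinuous _ _).ae_le (ae_restrict_mem measurableSet_Ici)
  have hKν : ∀ p, 0 < p → ∫ x, (1 + x) / (p + x) ∂ν = K p := by
    intro p hp
    rw [hK_st p hp, integral_withDensity_eq_integral_toReal_smul hmeas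
      (ae_of_all _ fun _ => ENNReal.ofReal_lt_top)]
    refine setIntegral_congr_fun measurableSet_Ici fun t ht => ?_
    have ht : 0 ≤ t := ht
    have h1 : 0 < 1 + t := by linarith
    have h2 : 0 < p + t := by linarith
    simp only [smul_eq_mul, ENNReal.toReal_ofReal (inv_pos.2 h1).le]
    field_simp
  obtain ⟨P, hP⟩ := exists_probabilityMeasure_stieltjes ν hν0 hlam
  have hP' : ∀ p, 0 < p →
      ∫ u, compactCauchyKernel p u ∂(P : Measure unitInterval) = K p / (p * K p + lam) := by
    intro p hp
    rw [← hP p hp, hKν p hp]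
  have hP0 : (P : Measure unitInterval) {0} = 0 := by
    refine measure_zero_eq_zero_of_tendsto _ ?_
    have h1 : Tendsto (fun p => 1 - lam / (p * K p + lam)) atTop (nhds (1 - 0)) :=
      (tendsto_const_nhds.div_atTop (tendsto_atTop_add_const_right _ lam hpK_inf)).const_sub 1
    rw [sub_zero] at h1
    refine h1.congr' ?_
    filter_upwards [eventually_gt_atTop 0, hpK_inf.eventually_ge_atTop 0] with p hp hpK
    have hd : p * K p + lam ≠ 0 := by positivity
    rw [hP' p hp]
    field_simp
    ring
  let X : unitInterval → ℝ := fun u => min 0 (1 - (u : ℝ)⁻¹)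
  have hX : Measurable X := by fun_prop
  have hX0 : ∀ u, X u ≤ 0 := fun u => min_le_left _ _
  refine ⟨ProbabilityTheory.mgf X P, completelyMonotone_mgf hX hX0,
    fun t ht => mgf_mem_Icc_of_nonpos hX hX0 ht,
    fun p hp => integrableOn_exp_neg_mul_mgf hX hX0 hp, fun p hp => ?_,
    tendsto_mgf_nhdsGT_zero hX hX0⟩
  rw [integral_exp_neg_mul_mgf hX hX0 hp, ← hP' p hp]
  exact integral_inv_sub_eq_integral_compactCauchyKernel hP0 p
end
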